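/- arXiv:2311.02518 — 2 statements merged into one kernel-verified Lean document; each statement's English description precedes it below -/
import Mathlib

section
/- Let P be a polynomial with complex coefficients of degree d ≥ 2 and let f : ℂ → ℂ be given by f(z) = P(z). Let z₀ ∈ ℂ with f^[p](z₀) = z₀ for some p ≥ 1, and suppose the multiplier λ = (f^[p])'(z₀) is a root of unity of exact order r ≥ 1 (a parabolic cycle). Then there exist a critical point c of f (i.e. P'(c) = 0) and an index 0 ≤ i < p such that f^[n·p·r](c) → f^[i](z₀) as n → ∞, while f^[n](c) ≠ f^[m](z₀) for all n, m ≥ 0. -/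
open Filter Topology

namespace Polynomial

theorem exists_eval_rightInverse_on_ball (Q : Polynomial ℂ) {z : ℂ} {ρ : ℝ} (hρ : 0 < ρ)
    (hcrit : ∀ x, Q.eval x ∈ Metric.ball (Q.eval z) ρ → Q.derivative.eval x ≠ 0) :
    ∃ h : ℂ → ℂ, DifferentiableOn ℂ h (Metric.ball (Q.eval z) ρ) ∧ h (Q.eval z) = z ∧
      ∀ x ∈ Metric.ball (Q.eval z) ρ, Q.eval (h x) = x := by
  classical
  set B := Metric.ball (Q.eval z) ρ with hB
  have hBo : IsOpen B := Metric.isOpen_ball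
  have hmem : Q.eval z ∈ B := Metric.mem_ball_self hρ
  have : ContractibleSpace B := (convex_ball _ _).contractibleSpace ⟨_, hmem⟩
  have : LocallyPathConnectedSpace B := hBo.locallyPathConnectedSpace
  have hval : ∀ x : B, (x : ℂ) ∈ (Q.eval '' {k | Q.derivative.eval k = 0})ᶜ := by
    rintro ⟨x, hx⟩ ⟨y, hy, hyx⟩
    change Q.eval y = x at hyx
    exact hcrit y (hyx.symm ▸ hx) hy
  obtain ⟨F, ⟨hF0, hF⟩, -⟩ := Q.isCoveringMapOn_eval.existsUnique_continuousMap_lifts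
    (⟨Subtype.val, continuous_subtype_val⟩ : C(B, ℂ)) (a₀ := ⟨_, hmem⟩) (e₀ := z) rfl hval
  have hFx : ∀ x : B, Q.eval (F x) = x := fun x => congrFun hF x
  let h : ℂ → ℂ := fun x => if hx : x ∈ B then F ⟨x, hx⟩ else 0
  have hh : ∀ x (hx : x ∈ B), h x = F ⟨x, hx⟩ := fun x hx => dif_pos hx
  have hinv : ∀ x ∈ B, Q.eval (h x) = x := fun x hx => by rw [hh x hx]; exact hFx _
  have hcont : ContinuousOn h B := by
    rw [continuousOn_iff_continuous_domRestrict]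
    convert F.continuous using 1
    ext x
    exact hh x x.2
  refine ⟨h, fun x hx => ?_, (hh _ hmem).trans hF0, hinv⟩
  have hd := (Q.hasDerivAt (h x)).of_local_left_inverse (hcont.continuousAt (hBo.mem_nhds hx))
    (hcrit _ (by rw [hinv x hx]; exact hx))
    (Filter.eventually_of_mem (hBo.mem_nhds hx) hinv)
  exact hd.differentiableAt.differentiableWithinAt

theorem le_mul_norm_eval_derivative_of_preimage_ball_subset (Q : Polynomial ℂ) {z : ℂ} {ρ R : ℝ}
    (hρ : 0 < ρ)
    (hcrit : ∀ x, Q.eval x ∈ Metric.ball (Q.eval z) ρ → Q.derivative.eval x ≠ 0)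
    (hR : ∀ x, Q.eval x ∈ Metric.ball (Q.eval z) ρ → ‖x‖ < R) :
    ρ ≤ 2 * R * ‖Q.derivative.eval z‖ := by
  obtain ⟨h, hd, hz, hinv⟩ := Q.exists_eval_rightInverse_on_ball hρ hcrit
  have hmem := Metric.mem_ball_self (x := Q.eval z) hρ
  have hzR : ‖z‖ < R := hR z hmem
  have hmaps : Set.MapsTo h (Metric.ball (Q.eval z) ρ) (Metric.ball (h (Q.eval z)) (2 * R)) := by
    intro x hx
    rw [hz, Metric.mem_ball, dist_eq_norm]
    have := hR (h x) (by rw [hinv x hx]; exact hx)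
    linarith [norm_sub_le (h x) z]
  have hb := Complex.norm_deriv_le_div_of_mapsTo_ball hd
    (hmaps.mono_right Metric.ball_subset_closedBall) hρ
  have hda := (hd.differentiableAt (Metric.ball_mem_nhds _ hρ)).hasDerivAt
  have hcomp : HasDerivAt (fun x => Q.eval (h x))
      (Q.derivative.eval z * deriv h (Q.eval z)) (Q.eval z) := by
    have := Q.hasDerivAt (h (Q.eval z))
    rw [hz] at this
    exact HasDerivAt.comp (h₂ := fun x => Q.eval x) (Q.eval z) (by rw [hz]; exact this) hda
  have hid : HasDerivAt (fun x => Q.eval (h x)) 1 (Q.eval z) :=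
    (hasDerivAt_id _).congr_of_eventuallyEq
      (Filter.eventually_of_mem (Metric.ball_mem_nhds _ hρ) hinv)
  have h1 : ‖Q.derivative.eval z‖ * ‖deriv h (Q.eval z)‖ = 1 := by
    rw [← norm_mul, hcomp.unique hid, norm_one]
  have h2 : 1 ≤ ‖Q.derivative.eval z‖ * (2 * R / ρ) := by
    rw [← h1]; gcongr
  rw [← mul_div_assoc, le_div_iff₀ hρ] at h2
  linarith

theorem eval_derivative_iterate_comp (g : Polynomial ℂ) (n : ℕ) (z : ℂ) :
    (g.comp^[n] X).derivative.eval z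
      = ∏ j ∈ Finset.range n, g.derivative.eval ((fun x => g.eval x)^[j] z) := by
  induction n with
  | zero => simp
  | succ n ih =>
    rw [Function.iterate_succ_apply', derivative_comp, eval_mul, eval_comp, ih,
      Finset.prod_range_succ, iterate_comp_eval, eval_X]

theorem exists_eq_X_mul_one_add_X_pow_mul {g : Polynomial ℂ} (hdeg : 2 ≤ g.natDegree)
    (h0 : g.eval 0 = 0) (h1 : g.derivative.eval 0 = 1) :
    ∃ (k : ℕ) (q : Polynomial ℂ), 1 ≤ k ∧ q.eval 0 ≠ 0 ∧ g = X * (1 + X ^ k * q) := by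
  have hne : g - X ≠ 0 := by
    intro h
    rw [sub_eq_zero.mp h, natDegree_X] at hdeg
    omega
  obtain ⟨q, hq, hnd⟩ := exists_eq_pow_rootMultiplicity_mul_and_not_dvd _ hne 0
  rw [dvd_iff_isRoot, IsRoot.def] at hnd
  simp only [map_zero, sub_zero] at hq
  obtain hm | hm | ⟨k, hm⟩ : (g - X).rootMultiplicity 0 = 0 ∨ (g - X).rootMultiplicity 0 = 1 ∨
      ∃ k, (g - X).rootMultiplicity 0 = k + 2 := by
    generalize (g - X).rootMultiplicity 0 = m
    rcases m with _ | _ | k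
    · exact Or.inl rfl
    · exact Or.inr (Or.inl rfl)
    · exact Or.inr (Or.inr ⟨k, rfl⟩)
  · rw [hm] at hq
    have := congrArg (eval 0) hq
    simp [h0] at this
    exact absurd this.symm hnd
  · rw [hm] at hq
    have := congrArg (fun s => eval 0 (derivative s)) hq
    simp [h1] at this
    exact absurd this.symm hnd
  · refine ⟨k + 1, q, by omega, hnd, ?_⟩
    rw [hm] at hq
    rw [eq_add_of_sub_eq hq]
    ring

theorem exists_forall_norm_le_norm_eval {k : ℕ} (hk : 1 ≤ k) {q : Polynomial ℂ}
    (hq : q.eval 0 ≠ 0) :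
    ∃ R : ℝ, ∀ z, R ≤ ‖z‖ → ‖z‖ ≤ ‖(X * (1 + X ^ k * q)).eval z‖ := by
  have hq0 : q ≠ 0 := by rintro rfl; simp at hq
  have hdeg : 0 < (1 + X ^ k * q).degree := by
    apply natDegree_pos_iff_degree_pos.mp
    rw [add_comm, ← C_1, natDegree_add_C, natDegree_X_pow_mul _ hq0]
    omega
  have ht := tendsto_norm_atTop _ hdeg (l := comap norm atTop) (z := id) tendsto_comap
  obtain ⟨s, hs, hsub⟩ := ht.eventually_ge_atTop 1
  obtain ⟨R, hR⟩ := mem_atTop_sets.mp hs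
  refine ⟨R, fun z hz => ?_⟩
  have : 1 ≤ ‖(1 + X ^ k * q).eval z‖ := hsub (hR _ hz)
  rw [eval_mul, eval_X, norm_mul]
  exact le_mul_of_one_le_right (norm_nonneg _) this

end Polynomial

/-- The coordinate `-1 / (k a zᵏ)`, in which `z ↦ z + a zᵏ⁺¹ + ⋯` is close to `w ↦ w + 1`. -/
noncomputable def petalCoord (k : ℕ) (a z : ℂ) : ℂ := -((k : ℂ) * a * z ^ k)⁻¹

theorem norm_lt_of_lt_norm_petalCoord {k : ℕ} (hk : 1 ≤ k) {a : ℂ} (ha : a ≠ 0) {δ : ℝ}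
    (hδ : 0 < δ) {z : ℂ} (hz : (k * ‖a‖ * δ ^ k)⁻¹ < ‖petalCoord k a z‖) : ‖z‖ < δ := by
  by_contra! h
  refine hz.not_ge ?_
  have hk' : (0 : ℝ) < k := by exact_mod_cast hk
  have ha' : 0 < ‖a‖ := norm_pos_iff.mpr ha
  rw [petalCoord, norm_neg, norm_inv, norm_mul, norm_mul, norm_pow, Complex.norm_natCast]
  gcongr

theorem ne_zero_of_re_petalCoord_pos {k : ℕ} (hk : 1 ≤ k) {a z : ℂ}
    (hz : 0 < (petalCoord k a z).re) : z ≠ 0 := by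
  rintro rfl
  rw [petalCoord, zero_pow (by omega)] at hz
  simp at hz

theorem exists_petalCoord_eq {k : ℕ} (hk : 1 ≤ k) {a : ℂ} (ha : a ≠ 0) {w : ℂ} (hw : w ≠ 0) :
    ∃ z, petalCoord k a z = w := by
  obtain ⟨z, hz⟩ := IsAlgClosed.exists_pow_nat_eq (-(k * a * w)⁻¹) hk
  have hk' : (k : ℂ) ≠ 0 := by exact_mod_cast (by omega : k ≠ 0)
  refine ⟨z, ?_⟩
  rw [petalCoord, hz]
  field_simp

theorem tendsto_zero_of_tendsto_re_petalCoord {k : ℕ} (hk : 1 ≤ k) {a : ℂ} (ha : a ≠ 0)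
    {s : ℕ → ℂ} (hs : Tendsto (fun n => (petalCoord k a (s n)).re) atTop atTop) :
    Tendsto s atTop (𝓝 0) := by
  rw [Metric.tendsto_nhds]
  intro δ hδ
  filter_upwards [hs.eventually_gt_atTop (k * ‖a‖ * δ ^ k)⁻¹] with n hn
  rw [dist_zero_right]
  exact norm_lt_of_lt_norm_petalCoord hk ha hδ (hn.trans_le (Complex.re_le_norm _))

theorem exists_petalCoord_re_gt_on_ball (k : ℕ) (a : ℂ) : ∃ σ : ℝ, 0 < σ ∧
    ∀ z x : ℂ, z ≠ 0 → x ∈ Metric.ball z (σ * ‖z‖) →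
      ‖petalCoord k a z‖ ≤ 3 * (petalCoord k a z).re →
      (petalCoord k a z).re / 2 ≤ (petalCoord k a x).re := by
  have hc : ContinuousAt (fun s : ℂ => (s ^ k)⁻¹) 1 :=
    (continuousAt_id.pow k).inv₀ (by simp)
  obtain ⟨σ, hσ, hball⟩ := Metric.continuousAt_iff.mp hc (1 / 6) (by norm_num)
  refine ⟨σ, hσ, fun z x hz hx hu => ?_⟩
  have hzn : 0 < ‖z‖ := norm_pos_iff.mpr hz
  have hs : dist (x / z) 1 < σ := by
    rw [dist_eq_norm, div_sub_one hz, norm_div, div_lt_iff₀ hzn]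
    simpa [dist_eq_norm] using hx
  have hd := hball hs
  rw [dist_eq_norm] at hd
  simp only [one_pow, inv_one] at hd
  have hx' : petalCoord k a x
      = petalCoord k a z + petalCoord k a z * (((x / z) ^ k)⁻¹ - 1) := by
    have : x ^ k = z ^ k * (x / z) ^ k := by rw [← mul_pow, mul_div_cancel₀ _ hz]
    simp only [petalCoord]
    rw [this, ← mul_assoc, mul_inv]
    ring
  have hn : ‖petalCoord k a z * (((x / z) ^ k)⁻¹ - 1)‖ ≤ ‖petalCoord k a z‖ * (1 / 6) := by
    rw [norm_mul]; gcongr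
  have hre := (abs_le.mp (Complex.abs_re_le_norm
    (petalCoord k a z * (((x / z) ^ k)⁻¹ - 1)))).1
  rw [hx', Complex.add_re]
  linarith

theorem norm_one_sub_inv_le {u : ℂ} (hu : 6 ≤ ‖u‖) (hre : ‖u‖ ≤ 3 * u.re) :
    ‖1 - u⁻¹‖ ≤ 1 - 1 / 4 * ‖u⁻¹‖ := by
  have h0 : 0 < ‖u‖ := by linarith
  have hu0 : u ≠ 0 := norm_pos_iff.mp h0
  have h1 : ‖u - 1‖ ≤ ‖u‖ - 1 / 4 := by
    apply le_of_sq_le_sq _ (by linarith)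
    have e1 : ‖u - 1‖ ^ 2 = ‖u‖ ^ 2 - 2 * u.re + 1 := by
      rw [← Complex.normSq_eq_norm_sq, ← Complex.normSq_eq_norm_sq, Complex.normSq_apply,
        Complex.normSq_apply]
      simp
      ring
    rw [e1]
    nlinarith
  have e : 1 - u⁻¹ = (u - 1) / u := by field_simp
  rw [e, norm_div, norm_inv, div_le_iff₀ h0, sub_mul, mul_assoc,
    inv_mul_cancel₀ h0.ne']
  linarith

section Orbit

variable {g u : ℂ → ℂ} {C : ℝ}

theorem re_add_half_le_re_iterate (H : ∀ z, C < (u z).re → ‖u (g z) - u z - 1‖ ≤ 1 / 2)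
    {z : ℂ} (hz : C < (u z).re) (n : ℕ) : (u z).re + n / 2 ≤ (u (g^[n] z)).re := by
  induction n with
  | zero => simp
  | succ n ih =>
    have hn : (0 : ℝ) ≤ n := n.cast_nonneg
    have h := (abs_le.mp ((Complex.abs_re_le_norm _).trans (H (g^[n] z) (by linarith)))).1
    rw [Function.iterate_succ_apply']
    simp only [Complex.sub_re, Complex.one_re] at h
    push_cast
    linarith

theorem norm_iterate_le_add (H : ∀ z, C < (u z).re → ‖u (g z) - u z - 1‖ ≤ 1 / 2)
    {z : ℂ} (hz : C < (u z).re) (n : ℕ) : ‖u (g^[n] z)‖ ≤ ‖u z‖ + 3 * n / 2 := by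
  induction n with
  | zero => simp
  | succ n ih =>
    have hn : (0 : ℝ) ≤ n := n.cast_nonneg
    have hre := re_add_half_le_re_iterate H hz n
    have h := H (g^[n] z) (by linarith)
    rw [Function.iterate_succ_apply']
    have e : u (g (g^[n] z)) = (u (g (g^[n] z)) - u (g^[n] z) - 1) + u (g^[n] z) + 1 := by ring
    have h3 : ‖u (g (g^[n] z))‖
        ≤ ‖u (g (g^[n] z)) - u (g^[n] z) - 1‖ + ‖u (g^[n] z)‖ + 1 := by
      conv_lhs => rw [e]
      exact (norm_add_le _ _).trans (by rw [norm_one]; gcongr; exact norm_add_le _ _)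
    push_cast
    linarith

theorem tendsto_re_iterate_atTop (H : ∀ z, C < (u z).re → ‖u (g z) - u z - 1‖ ≤ 1 / 2)
    {z : ℂ} (hz : C < (u z).re) : Tendsto (fun n => (u (g^[n] z)).re) atTop atTop := by
  refine tendsto_atTop_mono (re_add_half_le_re_iterate H hz) ?_
  exact tendsto_atTop_add_const_left _ _ (tendsto_natCast_atTop_atTop.atTop_div_const two_pos)

theorem prod_iterate_eq_prod_mul_div (g' : ℂ → ℂ) {z : ℂ} (hz : ∀ n, g^[n] z ≠ 0) (n : ℕ) :
    ∏ j ∈ Finset.range n, g' (g^[j] z)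
      = (∏ j ∈ Finset.range n, g^[j] z * g' (g^[j] z) / g (g^[j] z)) * (g^[n] z / z) := by
  induction n with
  | zero =>
    have h0 : z ≠ 0 := hz 0
    simp [h0]
  | succ n ih =>
    have h1 := hz (n + 1)
    have h0 : z ≠ 0 := hz 0
    rw [Function.iterate_succ_apply'] at h1 ⊢
    have h2 := hz n
    rw [Finset.prod_range_succ, Finset.prod_range_succ, ih]
    field_simp

end Orbit

theorem tendsto_prod_zero_of_le_one_sub_div {x : ℕ → ℝ} {c : ℝ} (hc : 0 < c)
    (hx0 : ∀ n, 0 ≤ x n) (hx : ∀ n, x n ≤ 1 - c * (1 / (n + 1))) :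
    Tendsto (fun n => ∏ j ∈ Finset.range n, x j) atTop (𝓝 0) := by
  refine squeeze_zero (fun n => Finset.prod_nonneg fun j _ => hx0 j)
    (g := fun n => Real.exp (-(c * ∑ j ∈ Finset.range n, (1 / (j + 1) : ℝ)))) (fun n => ?_) ?_
  · rw [Finset.mul_sum, ← Finset.sum_neg_distrib, Real.exp_sum]
    refine Finset.prod_le_prod (fun j _ => hx0 j) fun j _ => (hx j).trans ?_
    have := Real.add_one_le_exp (-(c * (1 / ((j : ℝ) + 1))))
    linarith
  · exact Real.tendsto_exp_neg_atTop_nhds_zero.comp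
      (Real.tendsto_sum_range_one_div_nat_succ_atTop.const_mul_atTop hc)

namespace Polynomial

theorem eventually_petalCoord_estimates {k : ℕ} (hk : 1 ≤ k) {q : Polynomial ℂ}
    (hq : q.eval 0 ≠ 0) {g : Polynomial ℂ} (hg : g = X * (1 + X ^ k * q)) :
    ∀ᶠ z in 𝓝 (0 : ℂ), z ≠ 0 →
      ‖petalCoord k (q.eval 0) (g.eval z) - petalCoord k (q.eval 0) z - 1‖ ≤ 1 / 2 ∧
      ‖z * g.derivative.eval z / g.eval z - (1 - (petalCoord k (q.eval 0) z)⁻¹)‖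
        ≤ 1 / 8 * ‖(petalCoord k (q.eval 0) z)⁻¹‖ := by
  have hk0 : k ≠ 0 := by omega
  have hkC : (k : ℂ) ≠ 0 := by exact_mod_cast hk0
  set a := q.eval 0 with ha
  have hqc : ContinuousAt (fun z => q.eval z) (0 : ℂ) := q.continuous.continuousAt
  have htc : ContinuousAt (fun z => z ^ k * q.eval z) (0 : ℂ) := (continuousAt_id.pow k).mul hqc
  have hne : ∀ᶠ z in 𝓝 (0 : ℂ), 1 + z ^ k * q.eval z ≠ 0 :=
    (continuousAt_const.add htc).eventually_ne (by simp [hk0])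
  have hφ : HasDerivAt (fun t : ℂ => ((1 + t) ^ k)⁻¹) (-k) 0 := by
    have h := ((((hasDerivAt_id (0 : ℂ)).const_add 1).pow k).inv (by simp))
    convert! h using 1
    simp
  set D := dslope (fun t : ℂ => ((1 + t) ^ k)⁻¹) 0 with hD
  have hDc : ContinuousAt D 0 := continuousAt_dslope_same.mpr hφ.differentiableAt
  have hD0 : D 0 = -k := by rw [hD, dslope_same, hφ.deriv]
  have hDt : ∀ t : ℂ, t * D t = ((1 + t) ^ k)⁻¹ - 1 := fun t => by
    simpa using sub_smul_dslope (fun t : ℂ => ((1 + t) ^ k)⁻¹) 0 t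
  have hlim1 : Tendsto (fun z => -(q.eval z * D (z ^ k * q.eval z)) / (k * a)) (𝓝 0) (𝓝 1) := by
    have hDcomp : ContinuousAt (fun z => D (z ^ k * q.eval z)) (0 : ℂ) :=
      ContinuousAt.comp (g := D) (by simpa [hk0] using hDc) htc
    have h : ContinuousAt (fun z => -(q.eval z * D (z ^ k * q.eval z)) / (k * a)) (0 : ℂ) :=
      (hqc.mul hDcomp).neg.div_const _
    have h' := h.tendsto
    simp only [zero_pow hk0, zero_mul, hD0] at h'
    rwa [show -(eval 0 q * -(k : ℂ)) / (k * a) = 1 by rw [← ha]; field_simp] at h'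
  have hlim2 : Tendsto (fun z => (k * q.eval z + z * q.derivative.eval z)
      / (1 + z ^ k * q.eval z) - k * a) (𝓝 0) (𝓝 0) := by
    have h : ContinuousAt (fun z => (k * q.eval z + z * q.derivative.eval z)
        / (1 + z ^ k * q.eval z) - k * a) (0 : ℂ) :=
      (((continuousAt_const.mul hqc).add
        (continuousAt_id.mul q.derivative.continuous.continuousAt)).div
        (continuousAt_const.add htc) (by simp [hk0])).sub continuousAt_const
    simpa [hk0, ha] using h.tendsto
  have he1 := (Metric.tendsto_nhds.mp hlim1) (1 / 2) (by norm_num)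
  have hka : 0 < ‖(k : ℂ) * a‖ := norm_pos_iff.mpr (mul_ne_zero hkC hq)
  have he2 := (Metric.tendsto_nhds.mp hlim2) (1 / 8 * ‖(k : ℂ) * a‖) (by positivity)
  filter_upwards [hne, he1, he2] with z hz h1 h2 hz0
  have hzk : z ^ k ≠ 0 := pow_ne_zero _ hz0
  have hge : g.eval z = z * (1 + z ^ k * q.eval z) := by simp [hg]
  rw [dist_eq_norm] at h1 h2
  constructor
  · refine le_of_eq_of_le (congrArg norm ?_) h1.le
    have e := hDt (z ^ k * q.eval z)
    simp only [petalCoord]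
    rw [hge, mul_pow, ← mul_assoc, mul_inv, sub_left_inj]
    rw [eq_add_of_sub_eq e.symm]
    field_simp
    ring
  · have hgd : g.derivative.eval z = 1 + z ^ k * q.eval z
        + (k * z ^ k * q.eval z + z ^ (k + 1) * q.derivative.eval z) := by
      obtain ⟨l, rfl⟩ : ∃ l, k = l + 1 := ⟨k - 1, by omega⟩
      simp [hg, derivative_mul]
      ring
    have e : z * g.derivative.eval z / g.eval z - (1 - (petalCoord k a z)⁻¹)
        = z ^ k * ((k * q.eval z + z * q.derivative.eval z)
          / (1 + z ^ k * q.eval z) - k * a) := by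
      rw [hgd, hge, petalCoord, inv_neg, inv_inv]
      field_simp
      ring
    rw [e, petalCoord, inv_neg, inv_inv, norm_neg, norm_mul, norm_mul (_ * _)]
    rw [sub_zero] at h2
    nlinarith [norm_nonneg (z ^ k), h2.le]

end Polynomial

namespace Polynomial

theorem exists_critical_tendsto_zero {g : Polynomial ℂ} (hdeg : 2 ≤ g.natDegree)
    (h0 : g.eval 0 = 0) (h1 : g.derivative.eval 0 = 1) :
    ∃ c, g.derivative.eval c = 0 ∧ Tendsto (fun n => (fun x => g.eval x)^[n] c) atTop (𝓝 0) ∧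
      ∀ n, (fun x => g.eval x)^[n] c ≠ 0 := by
  obtain ⟨k, q, hk, hq, hg⟩ := exists_eq_X_mul_one_add_X_pow_mul hdeg h0 h1
  obtain ⟨R₀, hR₀⟩ := exists_forall_norm_le_norm_eval hk hq
  rw [← hg] at hR₀
  obtain ⟨δ, hδ, hest⟩ := Metric.eventually_nhds_iff.mp (eventually_petalCoord_estimates hk hq hg)
  set u := petalCoord k (q.eval 0) with hu
  set F : ℂ → ℂ := fun x => g.eval x with hF
  set C : ℝ := max 6 (k * ‖q.eval 0‖ * δ ^ k)⁻¹ with hC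
  have hC6 : 6 ≤ C := le_max_left _ _
  have hsmall : ∀ z, C < (u z).re → ‖z‖ < δ := fun z hz =>
    norm_lt_of_lt_norm_petalCoord hk hq hδ
      (((le_max_right _ _).trans_lt hz).trans_le (Complex.re_le_norm _))
  have hne : ∀ z, C < (u z).re → z ≠ 0 := fun z hz =>
    ne_zero_of_re_petalCoord_pos hk ((by linarith : (0 : ℝ) < C).trans hz)
  have hest' : ∀ z, C < (u z).re → _ := fun z hz =>
    hest (by rw [dist_zero_right]; exact hsmall z hz) (hne z hz)
  have hshift : ∀ z, C < (u z).re → ‖u (F z) - u z - 1‖ ≤ 1 / 2 := fun z hz => (hest' z hz).1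
  have hinv : ∀ z, C < (u z).re → ∀ n, C < (u (F^[n] z)).re := fun z hz n => by
    have := re_add_half_le_re_iterate hshift hz n
    have hn : (0 : ℝ) ≤ n := n.cast_nonneg
    linarith
  have hzero : ∀ n, F^[n] 0 = 0 := fun n => Function.iterate_fixed h0 n
  by_contra! hcon
  have hcrit : ∀ m x, C < (u (F^[m] x)).re → (g.comp^[m] X).derivative.eval x ≠ 0 := by
    intro m x hx hd
    rw [eval_derivative_iterate_comp, Finset.prod_eq_zero_iff] at hd
    obtain ⟨j, hj, hjd⟩ := hd
    have hjm := Finset.mem_range.mp hj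
    have hsplit : F^[m] x = F^[m - j] (F^[j] x) := by
      rw [← Function.iterate_add_apply, Nat.sub_add_cancel hjm.le]
    obtain ⟨n, hn⟩ := hcon (F^[j] x) hjd <| by
      rw [← tendsto_add_atTop_iff_nat (m - j)]
      simp only [Function.iterate_add_apply]
      rw [← hsplit]
      exact tendsto_zero_of_tendsto_re_petalCoord hk hq (tendsto_re_iterate_atTop hshift hx)
    apply hne _ (hinv _ hx n)
    rw [hsplit, ← Function.iterate_add_apply, add_comm, Function.iterate_add_apply, hn, hzero]
  set R := max R₀ δ
  have hescape : ∀ n x, R ≤ ‖x‖ → R ≤ ‖F^[n] x‖ := by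
    intro n
    induction n with
    | zero => exact fun x hx => hx
    | succ n ih =>
      intro x hx
      exact ih _ (hx.trans (hR₀ x ((le_max_left _ _).trans hx)))
  obtain ⟨w, hw⟩ := exists_petalCoord_eq hk hq (w := ((4 * C : ℝ) : ℂ))
    (by exact_mod_cast (by linarith : 4 * C ≠ 0))
  rw [← hu] at hw
  have hwre : (u w).re = 4 * C := by rw [hw, Complex.ofReal_re]
  have hwnorm : ‖u w‖ = 4 * C := by
    rw [hw, Complex.norm_real, Real.norm_of_nonneg (by linarith)]
  have hwC : C < (u w).re := by linarith
  have hlow := fun n => re_add_half_le_re_iterate hshift hwC n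
  have hup := fun n => norm_iterate_le_add hshift hwC n
  have hsector : ∀ n, ‖u (F^[n] w)‖ ≤ 3 * (u (F^[n] w)).re := fun n => by
    linarith [hlow n, hup n]
  obtain ⟨σ, hσ, hball⟩ := exists_petalCoord_re_gt_on_ball k (q.eval 0)
  rw [← hu] at hball
  have hwn : ∀ n, F^[n] w ≠ 0 := fun n => hne _ (hinv w hwC n)
  have hwpos : 0 < ‖w‖ := norm_pos_iff.mpr (hwn 0)
  have hder : ∀ m, σ * ‖F^[m] w‖ ≤ 2 * R * ‖(g.comp^[m] X).derivative.eval w‖ := by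
    intro m
    have hev : ∀ x, (g.comp^[m] X).eval x = F^[m] x := fun x => by
      rw [iterate_comp_eval, eval_X]
    have hinball : ∀ x ∈ Metric.ball (F^[m] w) (σ * ‖F^[m] w‖), C < (u x).re := fun x hx => by
      have := hball _ x (hwn m) hx (hsector m)
      have hm : (0 : ℝ) ≤ m := m.cast_nonneg
      linarith [hlow m]
    refine le_mul_norm_eval_derivative_of_preimage_ball_subset _
      (mul_pos hσ (norm_pos_iff.mpr (hwn m))) (fun x hx => ?_) fun x hx => ?_
    · rw [hev, hev] at hx
      exact hcrit m x (hinball _ hx)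
    · rw [hev, hev] at hx
      by_contra! hx'
      exact ((hescape m x hx').trans_lt (hsmall _ (hinball _ hx))).not_ge (le_max_right _ _)
  set t : ℕ → ℝ := fun j => ‖F^[j] w * g.derivative.eval (F^[j] w) / F (F^[j] w)‖
  have htm : ∀ m, σ * ‖w‖ ≤ 2 * R * ∏ j ∈ Finset.range m, t j := by
    intro m
    have h := hder m
    have hpos : 0 < ‖F^[m] w‖ := norm_pos_iff.mpr (hwn m)
    rw [eval_derivative_iterate_comp, prod_iterate_eq_prod_mul_div (g := F) (fun x => g.derivative.eval x) hwn, norm_mul,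
      norm_prod, norm_div, ← mul_assoc, mul_div_assoc', le_div_iff₀ hwpos] at h
    refine le_of_mul_le_mul_right ?_ hpos
    linarith
  have ht : ∀ n, t n ≤ 1 - (1 / (32 * C + 12)) * (1 / (n + 1)) := by
    intro n
    have hnn : (0 : ℝ) ≤ n := n.cast_nonneg
    have hCn := hinv w hwC n
    have hun := hCn.trans_le (Complex.re_le_norm _)
    have hA := norm_one_sub_inv_le (by linarith) (hsector n)
    have hB := (hest' _ hCn).2
    have hD : t n ≤ ‖F^[n] w * g.derivative.eval (F^[n] w) / F (F^[n] w)
        - (1 - (u (F^[n] w))⁻¹)‖ + ‖1 - (u (F^[n] w))⁻¹‖ := norm_le_norm_sub_add _ _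
    have hE : (1 / (32 * C + 12)) * (1 / ((n : ℝ) + 1)) ≤ 1 / 8 * ‖(u (F^[n] w))⁻¹‖ := by
      rw [norm_inv, one_div_mul_one_div, ← one_div, one_div_mul_one_div]
      apply one_div_le_one_div_of_le (by linarith)
      nlinarith [hup n]
    linarith
  have hlim := (tendsto_prod_zero_of_le_one_sub_div (by positivity : 0 < 1 / (32 * C + 12))
    (fun n => norm_nonneg _) ht).const_mul (2 * R)
  rw [mul_zero] at hlim
  have := ge_of_tendsto' hlim htm
  nlinarith [mul_pos hσ hwpos]

end Polynomial

namespace Polynomial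

theorem exists_critical_tendsto_fixedPoint {g : Polynomial ℂ} (hdeg : 2 ≤ g.natDegree) {z₀ : ℂ}
    (h0 : g.eval z₀ = z₀) (h1 : g.derivative.eval z₀ = 1) :
    ∃ c, g.derivative.eval c = 0 ∧ Tendsto (fun n => (fun x => g.eval x)^[n] c) atTop (𝓝 z₀) ∧
      ∀ n, (fun x => g.eval x)^[n] c ≠ z₀ := by
  obtain ⟨c, hc, hlim, hne⟩ := exists_critical_tendsto_zero (g := g.comp (X + C z₀) - C z₀)
    (by rwa [natDegree_sub_C, natDegree_comp, natDegree_X_add_C, mul_one])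
    (by simp [h0]) (by simp [derivative_comp, h1])
  have hconj : ∀ n x, (fun x => (g.comp (X + C z₀) - C z₀).eval x)^[n] x
      = (fun x => g.eval x)^[n] (x + z₀) - z₀ := by
    intro n x
    induction n with
    | zero => simp
    | succ n ih => rw [Function.iterate_succ_apply', Function.iterate_succ_apply', ih]; simp
  simp only [hconj] at hlim hne
  refine ⟨c + z₀, by simpa [derivative_comp] using hc, ?_, fun n => sub_ne_zero.mp (hne n)⟩
  simpa using hlim.add_const z₀

end Polynomial

/-- Revision I1(2)/Corollary C2grp (polynomial case): if `z₀` is a parabolic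
periodic point of period `p` of a polynomial map `f` of degree at least `2`,
with multiplier a root of unity of exact order `r`, then some critical point
of `f` converges under iteration of `f^[p*r]` to a point of the cycle,
without its orbit ever meeting the cycle. -/
theorem parabolic_cycle_basin_contains_critical_point
    (P : Polynomial ℂ) (hP : 2 ≤ P.natDegree)
    (f : ℂ → ℂ) (hf : ∀ z, f z = P.eval z)
    (p : ℕ) (hp : 1 ≤ p) (z₀ : ℂ) (hper : f^[p] z₀ = z₀)
    (lam : ℂ) (hlam : deriv (f^[p]) z₀ = lam)
    (r : ℕ) (hr : 1 ≤ r) (hroot : lam ^ r = 1)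
    (hexact : ∀ m : ℕ, 0 < m → m < r → lam ^ m ≠ 1) :
    ∃ c : ℂ, P.derivative.eval c = 0 ∧ ∃ i : ℕ, i < p ∧
      Tendsto (fun n : ℕ => f^[n * (p * r)] c) atTop (𝓝 (f^[i] z₀)) ∧
      ∀ n m : ℕ, f^[n] c ≠ f^[m] z₀ := by
  obtain rfl : f = fun z => P.eval z := funext hf
  set f : ℂ → ℂ := fun z => P.eval z with hfdef
  have hcont : Continuous f := P.continuous
  set N := p * r with hN
  have hN1 : 1 ≤ N := Nat.mul_pos hp hr
  have heval : ∀ n x, (P.comp^[n] Polynomial.X).eval x = f^[n] x := fun n x => by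
    rw [Polynomial.iterate_comp_eval, Polynomial.eval_X]
  have hiter : ∀ n, (fun x => (P.comp^[N] Polynomial.X).eval x)^[n] = f^[n * N] := fun n => by
    rw [mul_comm, Function.iterate_mul f N n, ← funext (heval N)]
  have hfix : f^[N] z₀ = z₀ := by
    rw [hN, Function.iterate_mul]
    exact Function.iterate_fixed hper r
  have hderiv : (P.comp^[N] Polynomial.X).derivative.eval z₀ = 1 := by
    have hdiff : HasDerivAt f^[p] lam z₀ := by
      rw [← hlam, hasDerivAt_deriv_iff, ← funext (heval p)]
      exact Polynomial.differentiableAt _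
    have h := hdiff.iterate z₀ hper r
    rw [hroot, ← Function.iterate_mul, ← hN, ← funext (heval N)] at h
    exact (Polynomial.hasDerivAt _ _).unique h
  obtain ⟨b, hb, hlim, hne⟩ := Polynomial.exists_critical_tendsto_fixedPoint (z₀ := z₀)
    (by
      rw [Polynomial.natDegree_iterate_comp, Polynomial.natDegree_X, mul_one]
      exact hP.trans (Nat.le_self_pow (by omega) _))
    ((heval N z₀).trans hfix) hderiv
  simp only [hiter] at hlim hne
  rw [Polynomial.eval_derivative_iterate_comp, Finset.prod_eq_zero_iff] at hb
  obtain ⟨j, -, hj⟩ := hb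
  refine ⟨f^[j] b, hj, j % p, Nat.mod_lt _ hp, ?_, fun n m heq => ?_⟩
  · rw [Function.IsPeriodicPt.iterate_mod_apply (f := f) hper j]
    refine (((hcont.iterate j).tendsto z₀).comp hlim).congr fun n => ?_
    simp only [Function.comp_apply, ← Function.iterate_add_apply, add_comm]
  · rw [← Function.iterate_add_apply] at heq
    obtain ⟨s, hs⟩ : ∃ s, s + (n + j) = (n + j) * N :=
      ⟨(n + j) * N - (n + j), Nat.sub_add_cancel (Nat.le_mul_of_pos_right _ hN1)⟩
    have hland : f^[(n + j) * N] b = f^[s + m] z₀ := by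
      rw [← hs, Function.iterate_add_apply, heq, Function.iterate_add_apply]
    have hstay : ∀ l : ℕ, f^[(l + (n + j)) * N] b = f^[s + m] z₀ := fun l => by
      rw [add_mul, Function.iterate_add_apply, hland, ← Function.iterate_add_apply, add_comm,
        Function.iterate_add_apply, mul_comm, Function.iterate_mul, Function.iterate_fixed hfix]
    have hlim' := (tendsto_add_atTop_iff_nat (n + j)).mpr hlim
    simp only [hstay] at hlim'
    exact hne (n + j) (hland.trans (tendsto_nhds_unique tendsto_const_nhds hlim'))
end

section
/- Let R > 0 and a < b be real numbers, and let Ψ : ℝ × ℝ → ℂ be C^∞ up to the boundary {r = 0} on the half-open rectangle [0,R) × (a,b). Then for every θ₀ ∈ (a,b) there exist δ > 0, R' ∈ (0,R] and Φ : ℝ × ℝ → ℂ, C^∞ up to the boundary on [0,R') × (θ₀−δ, θ₀+δ), such that (1/2)·( r·∂Φ/∂r(r,θ) + i·∂Φ/∂θ(r,θ) ) = Ψ(r,θ) for all 0 < r < R' and |θ − θ₀| < δ. -/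
open Set Filter Topology MeasureTheory
open scoped ContDiff

namespace PolarDbar

lemma map_add_I_mul_map_I (A : ℂ →L[ℝ] ℂ) (v : ℂ) :
    A v + Complex.I * A (Complex.I * v)
      = (starRingEnd ℂ) v * (A 1 + Complex.I * A Complex.I) := by
  have h1 : A v = v.re * A 1 + v.im * A Complex.I := by
    conv_lhs => rw [show v = v.re • (1 : ℂ) + v.im • Complex.I by
      simp [Complex.re_add_im]]
    simp only [map_add, map_smul]
    simp only [Complex.real_smul]
  have h2 : A (Complex.I * v) = v.re * A Complex.I - v.im * A 1 := by
    conv_lhs => rw [show Complex.I * v = v.re • Complex.I - v.im • (1 : ℂ) by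
      apply Complex.ext <;> simp]
    simp only [map_sub, map_smul]
    simp only [Complex.real_smul]
  have h3 : (starRingEnd ℂ) v = v.re - v.im * Complex.I := by
    apply Complex.ext <;> simp
  rw [h1, h2, h3]
  linear_combination (v.im * A Complex.I : ℂ) * Complex.I_sq

lemma locallyIntegrable_inv : LocallyIntegrable (fun w : ℂ => w⁻¹) := by
  refine locallyIntegrable_of_norm_le_rpow (C := 1) (α := 1) (by simp) (by simp) ?_ ?_
  · refine Eventually.of_forall fun x => ?_
    simp [Real.rpow_neg_one]
  · exact measurable_inv.aestronglyMeasurable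

/-- The Cauchy–Pompeiu formula for compactly supported functions. -/
lemma integral_inv_mul_dbar {g : ℂ → ℂ} (hg : ContDiff ℝ 1 g) (hc : HasCompactSupport g) (z : ℂ) :
    ∫ w : ℂ, w⁻¹ * (fderiv ℝ g (z - w) 1 + Complex.I * fderiv ℝ g (z - w) Complex.I)
      = (2 * Real.pi : ℝ) * g z := by
  obtain ⟨B, hB⟩ := hc.isCompact.isBounded.exists_norm_le
  set e : ℝ → ℂ := fun φ => Complex.exp (φ * Complex.I) with he
  have henorm : ∀ φ, ‖e φ‖ = 1 := fun φ => Complex.norm_exp_ofReal_mul_I φ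
  have hecont : Continuous e := by fun_prop
  have hg0 : ∀ w, w ∉ tsupport g → g w = 0 := fun w => image_eq_zero_of_notMem_tsupport
  have hd0 : ∀ w, w ∉ tsupport g → fderiv ℝ g w = 0 := fun w hw =>
    image_eq_zero_of_notMem_tsupport fun h => hw (tsupport_fderiv_subset ℝ h)
  have hfar : ∀ ρ φ : ℝ, B + ‖z‖ < ρ → z - ρ * e φ ∉ tsupport g := by
    intro ρ φ hρ h
    have h1 := hB _ h
    have h2 : ‖(ρ * e φ : ℂ)‖ ≤ ‖z‖ + ‖z - ρ * e φ‖ := by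
      simpa using norm_sub_le z (z - ρ * e φ)
    rw [norm_mul, henorm, mul_one, Complex.norm_real] at h2
    linarith [Real.le_norm_self ρ]
  have hgc : Continuous (fderiv ℝ g) := hg.continuous_fderiv one_ne_zero
  have hgd : Differentiable ℝ g := hg.differentiable one_ne_zero
  set F : ℂ → ℝ × ℝ → ℂ := fun c p => fderiv ℝ g (z - p.1 * e p.2) (c * e p.2) with hF
  have hFc : ∀ c, Continuous (F c) := fun c => by
    refine Continuous.clm_apply (hgc.comp (by fun_prop)) (by fun_prop)
  have hFi : ∀ c, IntegrableOn (F c) (Ioi (0 : ℝ) ×ˢ Ioo (-Real.pi) Real.pi) := by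
    intro c
    have h1 : IntegrableOn (F c) (Icc 0 (B + ‖z‖) ×ˢ Icc (-Real.pi) Real.pi) :=
      (hFc c).continuousOn.integrableOn_compact (isCompact_Icc.prod isCompact_Icc)
    refine h1.of_forall_sdiff_eq_zero (measurableSet_Ioi.prod measurableSet_Ioo) ?_
    rintro ⟨ρ, φ⟩ ⟨⟨hρ, hφ⟩, h⟩
    have : B + ‖z‖ < ρ := by
      by_contra! hle
      exact h ⟨⟨le_of_lt hρ, hle⟩, Ioo_subset_Icc_self hφ⟩
    simp [hF, hd0 _ (hfar ρ φ this)]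
  have hpol : (∫ w : ℂ, w⁻¹ * (fderiv ℝ g (z - w) 1 + Complex.I * fderiv ℝ g (z - w) Complex.I))
      = ∫ p in Ioi (0 : ℝ) ×ˢ Ioo (-Real.pi) Real.pi, (F 1 p + Complex.I * F Complex.I p) := by
    rw [← Complex.integral_comp_polarCoord_symm]
    refine setIntegral_congr_fun (measurableSet_Ioi.prod measurableSet_Ioo) ?_
    rintro ⟨ρ, φ⟩ ⟨hρ, -⟩
    have hρ' : (ρ : ℂ) ≠ 0 := by exact_mod_cast (ne_of_gt hρ)
    have hpe : Complex.polarCoord.symm (ρ, φ) = ρ * e φ := by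
      simp [he, Complex.exp_mul_I]
    have hconj : (starRingEnd ℂ) (e φ) = (e φ)⁻¹ := by
      rw [Complex.inv_def, Complex.normSq_eq_norm_sq, henorm]; simp
    simp only [hpe, hF, one_mul, Complex.real_smul]
    rw [map_add_I_mul_map_I, hconj]
    field_simp
  have h1 : ∫ p in Ioi (0 : ℝ) ×ˢ Ioo (-Real.pi) Real.pi, F 1 p = (2 * Real.pi : ℝ) * g z := by
    rw [Measure.volume_eq_prod, ← setIntegral_prod_swap, setIntegral_prod]
    swap
    · have := (hFi 1)
      rw [Measure.volume_eq_prod] at this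
      exact this.swap
    have : ∀ φ : ℝ, ∫ ρ in Ioi (0 : ℝ), F 1 (Prod.swap (φ, ρ)) = g z := by
      intro φ
      have hder : ∀ ρ : ℝ, HasDerivAt (fun t : ℝ => g (z - t * e φ)) (- F 1 (ρ, φ)) ρ := by
        intro ρ
        have hin : HasDerivAt (fun t : ℝ => z - t * e φ) (-(e φ)) ρ := by
          simpa using ((Complex.ofRealCLM.hasDerivAt (x := ρ)).mul_const (e φ)).const_sub z
        exact ((hgd _).hasFDerivAt.comp_hasDerivAt ρ hin).congr_deriv (by simp [hF])
      have hlim : Tendsto (fun t : ℝ => g (z - t * e φ)) atTop (𝓝 0) := by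
        refine tendsto_const_nhds.congr' ?_
        filter_upwards [eventually_gt_atTop (B + ‖z‖)] with ρ hρ
        exact (hg0 _ (hfar ρ φ hρ)).symm
      have hint : IntegrableOn (fun ρ => - F 1 (ρ, φ)) (Ioi 0) := by
        have h1 : IntegrableOn (fun ρ => - F 1 (ρ, φ)) (Icc 0 (B + ‖z‖)) :=
          (((hFc 1).comp (by fun_prop : Continuous fun ρ : ℝ => (ρ, φ))).neg).continuousOn.integrableOn_compact
            isCompact_Icc
        refine h1.of_forall_sdiff_eq_zero measurableSet_Ioi ?_
        rintro ρ ⟨hρ, h⟩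
        have : B + ‖z‖ < ρ := by
          by_contra! hle
          exact h ⟨le_of_lt hρ, hle⟩
        simp [hF, hd0 _ (hfar ρ φ this)]
      have := integral_Ioi_of_hasDerivAt_of_tendsto' (fun x _ => hder x) hint hlim
      rw [integral_neg] at this
      simpa using this
    simp_rw [this]
    simp [Real.pi_pos.le, two_mul]
  have h2 : ∫ p in Ioi (0 : ℝ) ×ˢ Ioo (-Real.pi) Real.pi, F Complex.I p = 0 := by
    have := (hFi Complex.I)
    rw [Measure.volume_eq_prod] at this
    rw [Measure.volume_eq_prod, setIntegral_prod _ this]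
    refine (setIntegral_congr_fun measurableSet_Ioi (g := fun _ => (0 : ℂ)) ?_).trans (by simp)
    intro ρ hρ
    have hρ' : (ρ : ℂ) ≠ 0 := by exact_mod_cast (ne_of_gt hρ)
    have hder : ∀ φ : ℝ, HasDerivAt (fun t : ℝ => -(ρ : ℂ)⁻¹ * g (z - ρ * e t))
        (F Complex.I (ρ, φ)) φ := by
      intro φ
      have hin : HasDerivAt (fun t : ℝ => z - ρ * e t) (-(ρ • (Complex.I * e φ))) φ := by
        have := (((Complex.ofRealCLM.hasDerivAt (x := φ)).mul_const Complex.I).cexp.const_mul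
          (ρ : ℂ)).const_sub z
        refine this.congr_deriv ?_
        rw [Complex.real_smul]
        simp only [he, Complex.ofRealCLM_apply, Complex.ofReal_one]
        ring
      have := ((hgd _).hasFDerivAt.comp_hasDerivAt φ hin).const_mul (-(ρ : ℂ)⁻¹)
      refine this.congr_deriv ?_
      rw [map_neg, map_smul, Complex.real_smul, neg_mul_neg, inv_mul_cancel_left₀ hρ']
    have hcts : Continuous fun φ : ℝ => F Complex.I (ρ, φ) := (hFc _).comp (by fun_prop)
    have := intervalIntegral.integral_eq_sub_of_hasDerivAt (a := -Real.pi) (b := Real.pi)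
      (fun x _ => hder x) (hcts.intervalIntegrable _ _)
    rw [intervalIntegral.integral_of_le (by linarith [Real.pi_pos]),
      integral_Ioc_eq_integral_Ioo] at this
    simp only [this, he]
    simp [Complex.exp_neg, Complex.exp_pi_mul_I]
  rw [hpol, integral_add (hFi 1) ((hFi Complex.I).const_mul _), h1, integral_const_mul, h2]
  simp

lemma exists_dbar_eq {g : ℂ → ℂ} (hg : ContDiff ℝ ∞ g) (hc : HasCompactSupport g) :
    ∃ u : ℂ → ℂ, ContDiff ℝ ∞ u ∧
      ∀ z, fderiv ℝ u z 1 + Complex.I * fderiv ℝ u z Complex.I = g z := by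
  set L := ContinuousLinearMap.mul ℝ ℂ
  set k : ℂ → ℂ := fun w => w⁻¹
  have hk : LocallyIntegrable k := locallyIntegrable_inv
  have hg1 : ContDiff ℝ 1 g := hg.of_le (by simp)
  have hfd : Continuous (fderiv ℝ g) := hg1.continuous_fderiv one_ne_zero
  have hsm : ContDiff ℝ ∞ (convolution k g L volume) := hc.contDiff_convolution_right L hk hg
  refine ⟨fun z => ((2 * Real.pi : ℝ) : ℂ)⁻¹ * convolution k g L volume z,
    contDiff_const.mul hsm, fun z => ?_⟩
  have hder : ∀ v, fderiv ℝ (fun z => ((2 * Real.pi : ℝ) : ℂ)⁻¹ * convolution k g L volume z) z v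
      = ((2 * Real.pi : ℝ) : ℂ)⁻¹ * ∫ w, k w * fderiv ℝ g (z - w) v := by
    intro v
    rw [((hc.hasFDerivAt_convolution_right L hk hg1 z).const_mul _).fderiv]
    rw [_root_.smul_apply, smul_eq_mul,
      convolution_precompR_apply L hk (hc.fderiv ℝ) hfd]
    rfl
  have hint : ∀ v, Integrable fun w => k w * fderiv ℝ g (z - w) v := fun v =>
    HasCompactSupport.convolutionExists_right L (hc.fderiv_apply ℝ v) hk
      (hfd.clm_apply continuous_const) z
  rw [hder, hder, mul_left_comm, ← mul_add, ← integral_const_mul, ← integral_add (hint _)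
    ((hint _).const_mul _)]
  have := integral_inv_mul_dbar hg1 hc z
  rw [inv_mul_eq_iff_eq_mul₀ (by exact_mod_cast (by positivity : (2 * Real.pi : ℝ) ≠ 0)), ← this]
  refine integral_congr_ae (Eventually.of_forall fun w => ?_)
  simp only [k]; ring


section Polar

variable {F : Type*} [NormedAddCommGroup F] [NormedSpace ℝ F]

/-- Smooth functions of `(r, θ)` supported in `[0, ρ] × [-1, 1]`; these are flat at `r = 0`. -/
structure FlatSupported (ρ : ℝ) (H : ℝ × ℝ → F) : Prop where
  contDiff : ContDiff ℝ ∞ H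
  tsupport_subset : tsupport H ⊆ Icc 0 ρ ×ˢ Icc (-1) 1

namespace FlatSupported

variable {ρ : ℝ} {H : ℝ × ℝ → F}

lemma hasCompactSupport (h : FlatSupported ρ H) : HasCompactSupport H :=
  (isCompact_Icc.prod isCompact_Icc).of_isClosed_subset (isClosed_tsupport H) h.tsupport_subset

lemma eq_zero (h : FlatSupported ρ H) {p : ℝ × ℝ} (hp : p ∉ Icc 0 ρ ×ˢ Icc (-1 : ℝ) 1) :
    H p = 0 :=
  image_eq_zero_of_notMem_tsupport fun hp' => hp (h.tsupport_subset hp')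

lemma apply_zero_left (h : FlatSupported ρ H) (θ : ℝ) : H (0, θ) = 0 := by
  have hc : Continuous fun t : ℝ => H (t, θ) := h.contDiff.continuous.comp (by fun_prop)
  have h0 : EqOn (fun t : ℝ => H (t, θ)) 0 (Iio 0) := fun t ht =>
    h.eq_zero fun hp => (not_le.2 ht) hp.1.1
  have := h0.closure hc continuous_const
  rw [closure_Iio] at this
  exact this (mem_Iic.2 le_rfl)

lemma fderiv_right (h : FlatSupported ρ H) : FlatSupported ρ (fderiv ℝ H) :=
  ⟨h.contDiff.fderiv_right (by simp), (tsupport_fderiv_subset ℝ).trans h.tsupport_subset⟩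

lemma exists_norm_le (N : ℕ) : ∀ {F : Type*} [NormedAddCommGroup F] [NormedSpace ℝ F]
    {H : ℝ × ℝ → F}, FlatSupported ρ H →
    ∃ C, 0 ≤ C ∧ ∀ r θ : ℝ, 0 ≤ r → ‖H (r, θ)‖ ≤ C * r ^ N := by
  induction N with
  | zero =>
    intro F _ _ H h
    obtain ⟨C, hC⟩ := h.hasCompactSupport.exists_bound_of_continuous h.contDiff.continuous
    exact ⟨C, (norm_nonneg _).trans (hC 0), fun r θ _ => by simpa using hC (r, θ)⟩
  | succ N ih =>
    intro F _ _ H h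
    obtain ⟨C, hC0, hC⟩ := ih h.fderiv_right
    refine ⟨C, hC0, fun r θ hr => ?_⟩
    have hd : ∀ t ∈ Icc 0 r, HasDerivWithinAt (fun t : ℝ => H (t, θ))
        (fderiv ℝ H (t, θ) (1, 0)) (Icc 0 r) t := fun t _ =>
      ((h.contDiff.differentiable (by simp) _).hasFDerivAt.comp_hasDerivAt t
        ((hasDerivAt_id t).prodMk (hasDerivAt_const t θ))).hasDerivWithinAt
    have hb : ∀ t ∈ Icc 0 r, ‖fderiv ℝ H (t, θ) (1, 0)‖ ≤ C * r ^ N := by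
      intro t ht
      refine (ContinuousLinearMap.le_opNorm _ _).trans ?_
      have h1 : ‖((1 : ℝ), (0 : ℝ))‖ = 1 := by simp [Prod.norm_def]
      rw [h1, mul_one]
      refine (hC t θ ht.1).trans ?_
      have := ht.1
      have := ht.2
      gcongr
    have := (convex_Icc 0 r).norm_image_sub_le_of_norm_hasDerivWithin_le hd hb
      (left_mem_Icc.2 hr) (right_mem_Icc.2 hr)
    rw [h.apply_zero_left, sub_zero, sub_zero, Real.norm_of_nonneg hr] at this
    rw [pow_succ, ← mul_assoc]
    exact this

end FlatSupported

/-- The function `|z|⁻ᴺ H(|z|, arg z)`. -/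
noncomputable def polarPull (N : ℕ) (H : ℝ × ℝ → F) (z : ℂ) : F :=
  (‖z‖ ^ N)⁻¹ • H (‖z‖, z.arg)

/-- The function of `(r, θ)` describing the derivative of `polarPull N H`. -/
noncomputable def polarDeriv (N : ℕ) (H : ℝ × ℝ → F) (p : ℝ × ℝ) : ℂ →L[ℝ] F :=
  (Complex.reCLM.comp (ContinuousLinearMap.mul ℝ ℂ (Complex.exp (-(p.2 * Complex.I))))).smulRight
      (p.1 • fderiv ℝ H p (1, 0) - (N : ℝ) • H p)
    + (Complex.imCLM.comp (ContinuousLinearMap.mul ℝ ℂ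
        (Complex.exp (-(p.2 * Complex.I))))).smulRight (fderiv ℝ H p (0, 1))

variable {ρ : ℝ} {H : ℝ × ℝ → F}

lemma FlatSupported.polarDeriv_right (h : FlatSupported ρ H) (N : ℕ) :
    FlatSupported ρ (polarDeriv N H) := by
  constructor
  · have h1 : ContDiff ℝ ∞ (fderiv ℝ H) := h.fderiv_right.contDiff
    have h2 := h.contDiff
    have he : ContDiff ℝ ∞ fun p : ℝ × ℝ => Complex.exp (-(p.2 * Complex.I)) :=
      Complex.contDiff_exp.comp
        (((Complex.ofRealCLM.contDiff.comp contDiff_snd).mul contDiff_const).neg)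
    have hm : ContDiff ℝ ∞ fun p : ℝ × ℝ =>
        ContinuousLinearMap.mul ℝ ℂ (Complex.exp (-(p.2 * Complex.I))) :=
      (ContinuousLinearMap.mul ℝ ℂ).contDiff.comp he
    refine ContDiff.add (ContDiff.smulRight (contDiff_const.clm_comp hm) ?_)
      (ContDiff.smulRight (contDiff_const.clm_comp hm) (h1.clm_apply contDiff_const))
    exact (contDiff_fst.smul (h1.clm_apply contDiff_const)).sub (contDiff_const.smul h2)
  · refine (closure_minimal ?_ (isClosed_tsupport H)).trans h.tsupport_subset
    intro p hp
    by_contra hn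
    refine hp ?_
    have h1 : fderiv ℝ H p = 0 :=
      image_eq_zero_of_notMem_tsupport fun h' => hn (tsupport_fderiv_subset ℝ h')
    have h2 : H p = 0 := image_eq_zero_of_notMem_tsupport hn
    simp only [polarDeriv, h1, h2]
    ext v
    simp

lemma hasFDerivAt_arg {z : ℂ} (hz : z ∈ Complex.slitPlane) :
    HasFDerivAt Complex.arg (Complex.imCLM.comp (ContinuousLinearMap.mul ℝ ℂ z⁻¹)) z := by
  have h1 : HasFDerivAt Complex.log (ContinuousLinearMap.mul ℝ ℂ z⁻¹) z := by
    refine ((Complex.hasStrictDerivAt_log hz).hasDerivAt.hasFDerivAt.restrictScalars ℝ).congr_fderiv ?_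
    ext v
    simp [mul_comm]
  have := (Complex.imCLM.hasFDerivAt (x := Complex.log z)).comp z h1
  exact this.congr_of_eventuallyEq (Eventually.of_forall fun w => by simp [Complex.log_im])

lemma hasFDerivAt_norm {z : ℂ} (hz : z ∈ Complex.slitPlane) :
    HasFDerivAt (fun w : ℂ => ‖w‖)
      (‖z‖ • Complex.reCLM.comp (ContinuousLinearMap.mul ℝ ℂ z⁻¹)) z := by
  have hz0 := Complex.slitPlane_ne_zero hz
  have h1 : HasFDerivAt Complex.log (ContinuousLinearMap.mul ℝ ℂ z⁻¹) z := by
    refine ((Complex.hasStrictDerivAt_log hz).hasDerivAt.hasFDerivAt.restrictScalars ℝ).congr_fderiv ?_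
    ext v
    simp [mul_comm]
  have := ((Complex.reCLM.hasFDerivAt (x := Complex.log z)).comp z h1).exp
  simp only [Function.comp_apply, Complex.reCLM_apply, Complex.log_re,
    Real.exp_log (norm_pos_iff.2 hz0)] at this
  refine this.congr_of_eventuallyEq ?_
  filter_upwards [isOpen_ne.mem_nhds hz0] with w hw
  simp [Real.exp_log (norm_pos_iff.2 hw)]

lemma inv_eq_norm_inv_mul_exp (z : ℂ) :
    z⁻¹ = (‖z‖⁻¹ : ℝ) * Complex.exp (-(z.arg * Complex.I)) := by
  conv_lhs => rw [← Complex.norm_mul_exp_arg_mul_I z]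
  rw [mul_inv, ← Complex.exp_neg]
  simp

lemma hasFDerivAt_polarPull (h : FlatSupported ρ H) (N : ℕ) (z : ℂ) :
    HasFDerivAt (polarPull N H) (polarPull (N + 1) (polarDeriv N H) z) z := by
  rcases lt_or_ge z.re 0 with hre | hre
  · have hz : ∀ w : ℂ, w.re < 0 → (‖w‖, w.arg) ∉ Icc 0 ρ ×ˢ Icc (-1 : ℝ) 1 := by
      rintro w hw ⟨-, h1, h2⟩
      have h3 := Complex.abs_arg_le_pi_div_two_iff.not.2 (not_le.2 hw)
      exact h3 ((abs_le.2 ⟨h1, h2⟩).trans (by linarith [Real.pi_gt_three]))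
    have h0 : polarPull (N + 1) (polarDeriv N H) z = 0 := by
      simp [polarPull, (h.polarDeriv_right N).eq_zero (hz z hre)]
    rw [h0]
    refine (hasFDerivAt_const (0 : F) z).congr_of_eventuallyEq ?_
    filter_upwards [(isOpen_lt Complex.continuous_re continuous_const).mem_nhds hre] with w hw
    simp [polarPull, h.eq_zero (hz w hw)]
  rcases eq_or_ne z 0 with rfl | hz0
  · have h0 : polarPull (N + 1) (polarDeriv N H) 0 = 0 := by
      simp [polarPull]
    rw [h0]
    obtain ⟨C, hC0, hC⟩ := h.exists_norm_le (N + 2)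
    have hb : ∀ w : ℂ, ‖polarPull N H w‖ ≤ C * ‖w‖ ^ 2 := by
      intro w
      rcases eq_or_ne w 0 with rfl | hw
      · simp [polarPull, h.apply_zero_left]
      have hw' : 0 < ‖w‖ := norm_pos_iff.2 hw
      rw [polarPull, norm_smul, norm_inv, norm_pow, norm_norm, inv_mul_le_iff₀ (by positivity)]
      refine (hC _ _ hw'.le).trans (le_of_eq (by ring))
    have hO : (fun w : ℂ => polarPull N H w) =O[𝓝 0] fun w => ‖w - 0‖ ^ 2 :=
      Asymptotics.IsBigO.of_bound C (Eventually.of_forall fun w => by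
        simpa using hb w)
    exact hO.hasFDerivAt one_lt_two
  · have hs : z ∈ Complex.slitPlane := by
      rw [Complex.mem_slitPlane_iff]
      by_contra! hcon
      exact hz0 (Complex.ext (le_antisymm hcon.1 hre) hcon.2)
    have hr : ‖z‖ ≠ 0 := norm_ne_zero_iff.2 hz0
    have hpow : HasFDerivAt (fun w : ℂ => (‖w‖ ^ N)⁻¹) _ z :=
      (((hasDerivAt_pow N ‖z‖).inv (pow_ne_zero N hr)).comp_hasFDerivAt z (hasFDerivAt_norm hs))
    have hH := (h.contDiff.differentiable (by simp) (‖z‖, z.arg)).hasFDerivAt.comp z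
      ((hasFDerivAt_norm hs).prodMk (hasFDerivAt_arg hs))
    refine (hpow.smul hH).congr_fderiv ?_
    ext v
    set w : ℂ := Complex.exp (-(z.arg * Complex.I)) * v with hw
    have hzv : z⁻¹ * v = (‖z‖⁻¹ : ℝ) * w := by rw [inv_eq_norm_inv_mul_exp, hw, mul_assoc]
    have hlin : ∀ s t : ℝ, fderiv ℝ H (‖z‖, z.arg) (s, t)
        = s • fderiv ℝ H (‖z‖, z.arg) (1, 0) + t • fderiv ℝ H (‖z‖, z.arg) (0, 1) := by
      intro s t
      rw [← map_smul, ← map_smul, ← map_add]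
      simp
    simp only [polarPull, polarDeriv, Function.comp_apply, add_apply, _root_.smul_apply,
      ContinuousLinearMap.smulRight_apply, ContinuousLinearMap.comp_apply,
      ContinuousLinearMap.prod_apply, ContinuousLinearMap.mul_apply', Complex.reCLM_apply,
      Complex.imCLM_apply, hzv, ← hw, Complex.re_ofReal_mul, Complex.im_ofReal_mul]
    rw [hlin (‖z‖ • (‖z‖⁻¹ * w.re)) (‖z‖⁻¹ * w.im)]
    generalize fderiv ℝ H (‖z‖, z.arg) (1, 0) = X
    generalize fderiv ℝ H (‖z‖, z.arg) (0, 1) = Y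
    generalize H (‖z‖, z.arg) = Z
    rcases N with _ | N
    · simp
      match_scalars <;> field_simp
    · match_scalars <;> simp <;> field_simp <;> ring

lemma contDiff_polarPull (n : ℕ) : ∀ {F : Type*} [NormedAddCommGroup F] [NormedSpace ℝ F]
    {H : ℝ × ℝ → F} (_ : FlatSupported ρ H) (N : ℕ), ContDiff ℝ n (polarPull N H) := by
  induction n with
  | zero =>
    intro F _ _ H h N
    exact contDiff_zero.2 (Differentiable.continuous (𝕜 := ℝ) fun z =>
      (hasFDerivAt_polarPull h N z).differentiableAt)
  | succ n ih =>
    intro F _ _ H h N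
    exact_mod_cast contDiff_succ_iff_hasFDerivAt.2
      ⟨_, ih (h.polarDeriv_right N) (N + 1), hasFDerivAt_polarPull h N⟩

end Polar


lemma FlatSupported.exists_solution {ρ : ℝ} {H : ℝ × ℝ → ℂ} (h : FlatSupported ρ H) :
    ∃ Φ : ℝ × ℝ → ℂ, ContDiff ℝ ∞ Φ ∧ ∀ r θ : ℝ, 0 < r → |θ| < 1 →
      (r : ℂ) * deriv (fun t : ℝ => Φ (t, θ)) r
        + Complex.I * deriv (fun t : ℝ => Φ (r, t)) θ = H (r, θ) := by
  have he : ContDiff ℝ ∞ fun p : ℝ × ℝ => Complex.exp (p.2 * Complex.I) :=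
    Complex.contDiff_exp.comp ((Complex.ofRealCLM.contDiff.comp contDiff_snd).mul contDiff_const)
  have hK : FlatSupported ρ fun p => Complex.exp (p.2 * Complex.I) * H p :=
    ⟨he.mul h.contDiff, (tsupport_mul_subset_right).trans h.tsupport_subset⟩
  set g := polarPull 1 fun p => Complex.exp (p.2 * Complex.I) * H p with hg
  have hgs : ContDiff ℝ ∞ g := contDiff_infty.2 fun n => contDiff_polarPull n hK 1
  have hgc : HasCompactSupport g := by
    refine HasCompactSupport.intro (isCompact_closedBall (0 : ℂ) ρ) fun z hz => ?_
    have : (‖z‖, z.arg) ∉ Icc 0 ρ ×ˢ Icc (-1 : ℝ) 1 := fun hp =>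
      hz (mem_closedBall_zero_iff.2 hp.1.2)
    rw [hg, polarPull, hK.eq_zero this, smul_zero]
  obtain ⟨u, hu, hug⟩ := exists_dbar_eq hgs hgc
  have hud := hu.differentiable (by simp)
  refine ⟨fun p => u (p.1 * Complex.exp (p.2 * Complex.I)),
    hu.comp ((Complex.ofRealCLM.contDiff.comp contDiff_fst).mul he), fun r θ hr hθ => ?_⟩
  set z : ℂ := r * Complex.exp (θ * Complex.I) with hz
  have hd1 : HasDerivAt (fun t : ℝ => u (t * Complex.exp (θ * Complex.I)))
      (fderiv ℝ u z (Complex.exp (θ * Complex.I))) r := by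
    have hin : HasDerivAt (fun t : ℝ => (t : ℂ) * Complex.exp (θ * Complex.I))
        (Complex.exp (θ * Complex.I)) r := by
      simpa using (Complex.ofRealCLM.hasDerivAt (x := r)).mul_const (Complex.exp (θ * Complex.I))
    exact (hud z).hasFDerivAt.comp_hasDerivAt r hin
  have hd2 : HasDerivAt (fun t : ℝ => u (r * Complex.exp (t * Complex.I)))
      (fderiv ℝ u z (Complex.I * z)) θ := by
    have hin : HasDerivAt (fun t : ℝ => (r : ℂ) * Complex.exp (t * Complex.I))
        (Complex.I * z) θ := by
      have := ((Complex.ofRealCLM.hasDerivAt (x := θ)).mul_const Complex.I).cexp.const_mul (r : ℂ)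
      refine this.congr_deriv ?_
      simp only [hz, Complex.ofRealCLM_apply, Complex.ofReal_one]
      ring
    exact (hud z).hasFDerivAt.comp_hasDerivAt θ hin
  have hrz : (r : ℂ) * fderiv ℝ u z (Complex.exp (θ * Complex.I)) = fderiv ℝ u z z := by
    rw [← Complex.real_smul, ← map_smul, Complex.real_smul]
  rw [hd1.deriv, hd2.deriv, hrz, map_add_I_mul_map_I, hug]
  have hnorm : ‖z‖ = r := by
    rw [hz, norm_mul, Complex.norm_exp_ofReal_mul_I, mul_one, Complex.norm_real,
      Real.norm_of_nonneg hr.le]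
  have harg : z.arg = θ := by
    have := abs_lt.1 hθ
    rw [hz, Complex.exp_mul_I, Complex.arg_mul_cos_add_sin_mul_I hr]
    constructor <;> linarith [Real.pi_gt_three]
  have hr' : (r : ℂ) ≠ 0 := by exact_mod_cast hr.ne'
  have hconj : (starRingEnd ℂ) z * Complex.exp (θ * Complex.I) = r := by
    rw [hz, map_mul, ← Complex.exp_conj, mul_assoc, ← Complex.exp_add]
    simp
  simp only [hg, polarPull, hnorm, harg, Complex.real_smul, pow_one, Complex.ofReal_inv]
  rw [mul_left_comm, ← mul_assoc _ _ (H (r, θ)), hconj, inv_mul_cancel_left₀ hr']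


section Edge

/-- The closed half-plane `r ≥ 0` in the coordinates `(r, θ)`. -/
abbrev halfPlane : Set (ℝ × ℝ) := Ici 0 ×ˢ univ

lemma uniqueDiffOn_halfPlane : UniqueDiffOn ℝ halfPlane :=
  (uniqueDiffOn_Ici 0).prod uniqueDiffOn_univ

lemma halfPlane_subset_closure_interior : halfPlane ⊆ closure (interior halfPlane) := by
  rw [interior_prod_eq, closure_prod_eq, interior_Ici, closure_Ioi, interior_univ, closure_univ]

variable {F G : Type*} [NormedAddCommGroup F] [NormedSpace ℝ F]
  [NormedAddCommGroup G] [NormedSpace ℝ G]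

/-- The partial derivative in `r`, one-sided at the edge `r = 0`. -/
noncomputable def radialDeriv (f : ℝ × ℝ → F) (p : ℝ × ℝ) : F :=
  fderivWithin ℝ f halfPlane p (1, 0)

variable {f g : ℝ × ℝ → F}

lemma contDiffOn_fderivWithin_halfPlane (hf : ContDiffOn ℝ ∞ f halfPlane) :
    ContDiffOn ℝ ∞ (fderivWithin ℝ f halfPlane) halfPlane :=
  hf.fderivWithin uniqueDiffOn_halfPlane (by simp)

lemma contDiffOn_radialDeriv (hf : ContDiffOn ℝ ∞ f halfPlane) :
    ContDiffOn ℝ ∞ (radialDeriv f) halfPlane :=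
  (contDiffOn_fderivWithin_halfPlane hf).clm_apply contDiffOn_const

lemma contDiffOn_iterate_radialDeriv (hf : ContDiffOn ℝ ∞ f halfPlane) (k : ℕ) :
    ContDiffOn ℝ ∞ (radialDeriv^[k] f) halfPlane := by
  induction k with
  | zero => exact hf
  | succ k ih =>
    rw [Function.iterate_succ_apply']
    exact contDiffOn_radialDeriv ih

lemma eqOn_radialDeriv (h : EqOn f g halfPlane) :
    EqOn (radialDeriv f) (radialDeriv g) halfPlane := fun p hp => by
  rw [radialDeriv, fderivWithin_congr h (h hp), radialDeriv]

lemma eqOn_iterate_succ_radialDeriv {k : ℕ} (h : EqOn (radialDeriv^[k] f) g halfPlane) :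
    EqOn (radialDeriv^[k + 1] f) (radialDeriv g) halfPlane := by
  rw [Function.iterate_succ_apply']
  exact eqOn_radialDeriv h

lemma hasFDerivWithinAt_halfPlane (hf : ContDiffOn ℝ ∞ f halfPlane) {p : ℝ × ℝ}
    (hp : p ∈ halfPlane) :
    HasFDerivWithinAt f (fderivWithin ℝ f halfPlane p) halfPlane p :=
  (hf.differentiableOn (by simp) p hp).hasFDerivWithinAt

lemma fderivWithin_halfPlane_eq {f' : ℝ × ℝ →L[ℝ] F} {p : ℝ × ℝ} (hp : p ∈ halfPlane)
    (h : HasFDerivWithinAt f f' halfPlane p) : fderivWithin ℝ f halfPlane p = f' :=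
  h.fderivWithin (uniqueDiffOn_halfPlane p hp)

lemma radialDeriv_fderivWithin (hf : ContDiffOn ℝ ∞ f halfPlane) :
    EqOn (radialDeriv (fderivWithin ℝ f halfPlane))
      (fderivWithin ℝ (radialDeriv f) halfPlane) halfPlane := by
  intro p hp
  have hsymm : IsSymmSndFDerivWithinAt ℝ f halfPlane p :=
    (hf p hp).isSymmSndFDerivWithinAt
      (by simpa using WithTop.coe_le_coe.2 (le_top : (2 : ℕ∞) ≤ ⊤)) uniqueDiffOn_halfPlane
      (halfPlane_subset_closure_interior hp) hp
  have h := hasFDerivWithinAt_halfPlane (contDiffOn_fderivWithin_halfPlane hf) hp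
  have h2 := h.clm_apply (hasFDerivWithinAt_const ((1 : ℝ), (0 : ℝ)) p halfPlane)
  have h3 := fderivWithin_halfPlane_eq hp h2
  refine ContinuousLinearMap.ext fun v => ?_
  change fderivWithin ℝ (fderivWithin ℝ f halfPlane) halfPlane p (1, 0) v =
    fderivWithin ℝ (fun q => fderivWithin ℝ f halfPlane q (1, 0)) halfPlane p v
  rw [h3, hsymm.eq]
  simp

lemma iterate_radialDeriv_fderivWithin (hf : ContDiffOn ℝ ∞ f halfPlane) (k : ℕ) :
    EqOn (radialDeriv^[k] (fderivWithin ℝ f halfPlane))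
      (fderivWithin ℝ (radialDeriv^[k] f) halfPlane) halfPlane := by
  induction k with
  | zero => exact fun _ _ => rfl
  | succ k ih =>
    rw [Function.iterate_succ_apply' _ _ f]
    exact (eqOn_iterate_succ_radialDeriv ih).trans
      (radialDeriv_fderivWithin (contDiffOn_iterate_radialDeriv hf k))

lemma iterate_radialDeriv_clm (hf : ContDiffOn ℝ ∞ f halfPlane) (A : F →L[ℝ] G) (k : ℕ) :
    EqOn (radialDeriv^[k] fun p => A (f p)) (fun p => A (radialDeriv^[k] f p)) halfPlane := by
  induction k with
  | zero => exact fun _ _ => rfl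
  | succ k ih =>
    refine (eqOn_iterate_succ_radialDeriv ih).trans fun p hp => ?_
    have h := fderivWithin_halfPlane_eq (f := fun q => A (radialDeriv^[k] f q)) hp
      (A.hasFDerivAt.comp_hasFDerivWithinAt p
        (hasFDerivWithinAt_halfPlane (contDiffOn_iterate_radialDeriv hf k) hp))
    rw [Function.iterate_succ_apply', radialDeriv, h]
    rfl

lemma iterate_radialDeriv_add (hf : ContDiffOn ℝ ∞ f halfPlane)
    (hg : ContDiffOn ℝ ∞ g halfPlane) (k : ℕ) :
    EqOn (radialDeriv^[k] fun p => f p + g p)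
      (fun p => radialDeriv^[k] f p + radialDeriv^[k] g p) halfPlane := by
  induction k with
  | zero => exact fun _ _ => rfl
  | succ k ih =>
    refine (eqOn_iterate_succ_radialDeriv ih).trans fun p hp => ?_
    have h := fderivWithin_halfPlane_eq
      (f := fun q => radialDeriv^[k] f q + radialDeriv^[k] g q) hp
      ((hasFDerivWithinAt_halfPlane (contDiffOn_iterate_radialDeriv hf k) hp).add
        (hasFDerivWithinAt_halfPlane (contDiffOn_iterate_radialDeriv hg k) hp))
    rw [Function.iterate_succ_apply', Function.iterate_succ_apply', radialDeriv, h]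
    rfl

lemma iterate_radialDeriv_euler (hf : ContDiffOn ℝ ∞ f halfPlane) (k : ℕ) :
    EqOn (radialDeriv^[k] fun p => p.1 • radialDeriv f p)
      (fun p => p.1 • radialDeriv^[k + 1] f p + (k : ℝ) • radialDeriv^[k] f p) halfPlane := by
  induction k with
  | zero => intro p _; simp
  | succ k ih =>
    refine (eqOn_iterate_succ_radialDeriv ih).trans fun p hp => ?_
    have h := fderivWithin_halfPlane_eq
      (f := fun q => q.1 • radialDeriv^[k + 1] f q + (k : ℝ) • radialDeriv^[k] f q) hp
      ((hasFDerivWithinAt_fst.smul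
        (hasFDerivWithinAt_halfPlane (contDiffOn_iterate_radialDeriv hf (k + 1)) hp)).add
      ((hasFDerivWithinAt_halfPlane (contDiffOn_iterate_radialDeriv hf k) hp).const_smul (k : ℝ)))
    rw [Function.iterate_succ_apply' _ (k + 1), radialDeriv, h]
    have : radialDeriv^[k + 1] f p = fderivWithin ℝ (radialDeriv^[k] f) halfPlane p (1, 0) := by
      rw [Function.iterate_succ_apply']; rfl
    simp only [add_apply, _root_.smul_apply, ContinuousLinearMap.smulRight_apply,
      ContinuousLinearMap.coe_fst', ← this, radialDeriv]
    push_cast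
    module

lemma hasDerivAt_angular (hf : ContDiffOn ℝ ∞ f halfPlane) {r : ℝ} (hr : 0 ≤ r) (θ : ℝ) :
    HasDerivAt (fun t => f (r, t)) (fderivWithin ℝ f halfPlane (r, θ) (0, 1)) θ := by
  have h := hasFDerivWithinAt_halfPlane hf (p := (r, θ)) ⟨hr, mem_univ _⟩
  have := h.comp_hasDerivWithinAt (s := univ) θ
    ((hasDerivAt_const θ r).prodMk (hasDerivAt_id θ)).hasDerivWithinAt
    (fun t _ => ⟨hr, mem_univ _⟩)
  exact hasDerivWithinAt_univ.1 this

lemma hasDerivAt_radial (hf : ContDiffOn ℝ ∞ f halfPlane) {r : ℝ} (hr : 0 < r) (θ : ℝ) :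
    HasDerivAt (fun t => f (t, θ)) (radialDeriv f (r, θ)) r := by
  have h := (hasFDerivWithinAt_halfPlane hf (p := (r, θ)) ⟨hr.le, mem_univ _⟩).hasFDerivAt
    (prod_mem_nhds (Ici_mem_nhds hr) univ_mem)
  exact h.comp_hasDerivAt r ((hasDerivAt_id r).prodMk (hasDerivAt_const r θ))

/-- Smooth functions on the half-plane all of whose `r`-derivatives vanish on `{0} × I`. -/
structure FlatOnEdge (I : Set ℝ) (f : ℝ × ℝ → F) : Prop where
  contDiffOn : ContDiffOn ℝ ∞ f halfPlane
  iterate_eq_zero : ∀ k, ∀ θ ∈ I, radialDeriv^[k] f (0, θ) = 0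

variable {I : Set ℝ}

lemma FlatOnEdge.fderivWithin_right (hI : IsOpen I) (h : FlatOnEdge I f) :
    FlatOnEdge I (fderivWithin ℝ f halfPlane) := by
  refine ⟨contDiffOn_fderivWithin_halfPlane h.contDiffOn, fun k θ hθ => ?_⟩
  have hp : ((0 : ℝ), θ) ∈ halfPlane := ⟨mem_Ici.2 le_rfl, mem_univ _⟩
  rw [iterate_radialDeriv_fderivWithin h.contDiffOn k hp]
  have h1 : fderivWithin ℝ (radialDeriv^[k] f) halfPlane (0, θ) (1, 0) = 0 := by
    have := h.iterate_eq_zero (k + 1) θ hθ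
    rwa [Function.iterate_succ_apply'] at this
  have h2 : fderivWithin ℝ (radialDeriv^[k] f) halfPlane (0, θ) (0, 1) = 0 := by
    refine (hasDerivAt_angular (contDiffOn_iterate_radialDeriv h.contDiffOn k) le_rfl θ).unique
      ((hasDerivAt_const θ 0).congr_of_eventuallyEq ?_)
    filter_upwards [hI.mem_nhds hθ] with t ht using h.iterate_eq_zero k t ht
  ext <;> simp [h1, h2]

lemma FlatOnEdge.hasFDerivAt_indicator (hI : IsOpen I) (h : FlatOnEdge I f) {p : ℝ × ℝ}
    (hp : p.2 ∈ I) :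
    HasFDerivAt (halfPlane.indicator f)
      (halfPlane.indicator (fderivWithin ℝ f halfPlane) p) p := by
  rcases lt_or_ge p.1 0 with hneg | hpos
  · have hnot : ∀ q : ℝ × ℝ, q.1 < 0 → q ∉ halfPlane := fun q hq hq' => (not_le.2 hq) hq'.1
    rw [indicator_of_notMem (hnot p hneg)]
    refine (hasFDerivAt_const (0 : F) p).congr_of_eventuallyEq ?_
    filter_upwards [(isOpen_lt continuous_fst continuous_const).mem_nhds hneg] with q hq
    exact indicator_of_notMem (hnot q hq) f
  have hmem : p ∈ halfPlane := ⟨hpos, mem_univ _⟩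
  have h1 : HasFDerivWithinAt (halfPlane.indicator f) (fderivWithin ℝ f halfPlane p)
      halfPlane p :=
    (hasFDerivWithinAt_halfPlane h.contDiffOn hmem).congr
      (fun q hq => indicator_of_mem hq f) (indicator_of_mem hmem f)
  rw [indicator_of_mem hmem]
  rcases hpos.eq_or_lt with h0 | hpos
  · have hp0 : p = (0, p.2) := Prod.ext h0.symm rfl
    have hf0 : f p = 0 := by rw [hp0]; exact h.iterate_eq_zero 0 _ hp
    have hd0 : fderivWithin ℝ f halfPlane p = 0 := by
      rw [hp0]; exact (h.fderivWithin_right hI).iterate_eq_zero 0 _ hp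
    have h2 : HasFDerivWithinAt (halfPlane.indicator f) (fderivWithin ℝ f halfPlane p)
        halfPlaneᶜ p := by
      rw [hd0]
      refine (hasFDerivWithinAt_const (0 : F) p _).congr
        (fun q hq => indicator_of_notMem hq f) ?_
      rw [indicator_of_mem hmem, hf0]
    rw [← hasFDerivWithinAt_univ, ← union_compl_self halfPlane]
    exact h1.union h2
  · exact h1.hasFDerivAt (prod_mem_nhds (Ici_mem_nhds hpos) univ_mem)

lemma FlatOnEdge.contDiffOn_indicator (hI : IsOpen I) (n : ℕ) :
    ∀ {F : Type*} [NormedAddCommGroup F] [NormedSpace ℝ F] {f : ℝ × ℝ → F},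
      FlatOnEdge I f → ContDiffOn ℝ n (halfPlane.indicator f) (univ ×ˢ I) := by
  induction n with
  | zero =>
    intro F _ _ f h
    exact contDiffOn_zero.2 fun p hp =>
      (h.hasFDerivAt_indicator hI hp.2).continuousAt.continuousWithinAt
  | succ n ih =>
    intro F _ _ f h
    push_cast
    rw [contDiffOn_succ_iff_fderiv_of_isOpen (isOpen_univ.prod hI)]
    refine ⟨fun p hp =>
      (h.hasFDerivAt_indicator hI hp.2).differentiableAt.differentiableWithinAt, by simp, ?_⟩
    exact (ih (h.fderivWithin_right hI)).congr fun p hp =>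
      (h.hasFDerivAt_indicator hI hp.2).fderiv

end Edge


section Borel

variable {F : Type*} [NormedAddCommGroup F] [NormedSpace ℝ F]

lemma exists_summable_rescaling {h : ℕ → ℝ × ℝ → F} (hh : ∀ n, ContDiff ℝ ∞ (h n))
    (hc : ∀ n, HasCompactSupport (h n)) :
    ∃ ε : ℕ → ℝ, (∀ n, 0 < ε n) ∧ ∃ v : ℕ → ℕ → ℝ, (∀ k, Summable (v k)) ∧
      ∀ k n x, ‖iteratedFDeriv ℝ k
        (fun p : ℝ × ℝ => ε n ^ n • h n ((ε n)⁻¹ * p.1, p.2)) x‖ ≤ v k n := by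
  have hbound : ∀ n k, ∃ C, ∀ x, ‖iteratedFDeriv ℝ k (h n) x‖ ≤ C := fun n k =>
    ((hc n).iteratedFDeriv k).exists_bound_of_continuous
      ((hh n).continuous_iteratedFDeriv (by exact_mod_cast le_top))
  choose M hM using hbound
  have hM0 : ∀ n k, 0 ≤ M n k := fun n k => (norm_nonneg _).trans (hM n k 0)
  set S : ℕ → ℝ := fun n => 1 + ∑ k ∈ Finset.range n, M n k with hS
  have hS1 : ∀ n, 1 ≤ S n := fun n =>
    le_add_of_nonneg_right (Finset.sum_nonneg fun k _ => hM0 n k)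
  have hε : ∀ n, 0 < (1 / 2 : ℝ) ^ n / S n := fun n =>
    div_pos (by positivity) (zero_lt_one.trans_le (hS1 n))
  have hε1 : ∀ n, (1 / 2 : ℝ) ^ n / S n ≤ 1 := fun n =>
    (div_le_one (zero_lt_one.trans_le (hS1 n))).2
      ((pow_le_one₀ (by norm_num) (by norm_num)).trans (hS1 n))
  set ε : ℕ → ℝ := fun n => (1 / 2 : ℝ) ^ n / S n with hεdef
  refine ⟨ε, hε, fun k n => ε n ^ n * (M n k * (ε n)⁻¹ ^ k), fun k => ?_, fun k n x => ?_⟩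
  · refine Summable.of_norm_bounded_eventually_nat (g := fun n => (1 / 2 : ℝ) ^ n)
      (summable_geometric_of_lt_one (by norm_num) (by norm_num)) ?_
    filter_upwards [eventually_gt_atTop k] with n hn
    rw [Real.norm_of_nonneg (mul_nonneg (pow_pos (hε n) n).le
      (mul_nonneg (hM0 n k) (pow_pos (inv_pos.2 (hε n)) k).le))]
    have hle : M n k ≤ S n :=
      (Finset.single_le_sum (fun j _ => hM0 n j) (Finset.mem_range.2 hn)).trans
        (le_add_of_nonneg_left zero_le_one)
    have hpow : ε n ^ n * (ε n)⁻¹ ^ k ≤ ε n := by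
      have h1 : ε n ^ n = ε n ^ (n - k) * ε n ^ k := by rw [← pow_add, Nat.sub_add_cancel hn.le]
      rw [h1, mul_assoc, ← mul_pow, mul_inv_cancel₀ (hε n).ne', one_pow, mul_one]
      exact pow_le_of_le_one (hε n).le (hε1 n) (Nat.sub_ne_zero_of_lt hn)
    calc ε n ^ n * (M n k * (ε n)⁻¹ ^ k) = (ε n ^ n * (ε n)⁻¹ ^ k) * M n k := by ring
      _ ≤ ε n * S n := mul_le_mul hpow hle (hM0 n k) (hε n).le
      _ = (1 / 2 : ℝ) ^ n := div_mul_cancel₀ _ (zero_lt_one.trans_le (hS1 n)).ne'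
  · set L : ℝ × ℝ →L[ℝ] ℝ × ℝ :=
      ((ε n)⁻¹ • ContinuousLinearMap.fst ℝ ℝ ℝ).prod (ContinuousLinearMap.snd ℝ ℝ ℝ) with hL
    have hinv : 1 ≤ (ε n)⁻¹ := (one_le_inv₀ (hε n)).2 (hε1 n)
    have hLn : ‖L‖ ≤ (ε n)⁻¹ := by
      refine L.opNorm_le_bound (inv_pos.2 (hε n)).le fun p => ?_
      refine norm_prod_le_iff.2 ⟨?_, ?_⟩
      · change ‖(ε n)⁻¹ * p.1‖ ≤ _
        rw [norm_mul, Real.norm_of_nonneg (inv_pos.2 (hε n)).le]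
        exact mul_le_mul_of_nonneg_left (norm_fst_le p) (inv_pos.2 (hε n)).le
      · change ‖p.2‖ ≤ _
        exact (norm_snd_le p).trans (le_mul_of_one_le_left (norm_nonneg p) hinv)
    have hcomp : (fun p : ℝ × ℝ => ε n ^ n • h n ((ε n)⁻¹ * p.1, p.2)) =
        ε n ^ n • (h n ∘ L) := rfl
    have hk : ((k : ℕ∞) : WithTop ℕ∞) ≤ ∞ := by exact_mod_cast le_top
    rw [hcomp, iteratedFDeriv_const_smul_apply
      (((hh n).comp L.contDiff).of_le hk).contDiffAt, norm_smul,
      Real.norm_of_nonneg (pow_pos (hε n) n).le,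
      L.iteratedFDeriv_comp_right (hh n) x hk]
    refine mul_le_mul_of_nonneg_left ?_ (pow_pos (hε n) n).le
    refine (ContinuousMultilinearMap.norm_compContinuousLinearMap_le _ _).trans ?_
    rw [Finset.prod_const, Finset.card_univ, Fintype.card_fin]
    exact mul_le_mul (hM n k _) (pow_le_pow_left₀ (norm_nonneg _) hLn k) (by positivity) (hM0 n k)

lemma iteratedFDeriv_succ_radial {f : ℝ × ℝ → F} (hf : ContDiff ℝ ∞ f) (k : ℕ) (p : ℝ × ℝ) :
    HasFDerivAt (fun q => iteratedFDeriv ℝ k f q fun _ => (1, 0))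
      ((ContinuousMultilinearMap.apply ℝ (fun _ : Fin k => ℝ × ℝ) F fun _ => (1, 0)).comp
        (fderiv ℝ (iteratedFDeriv ℝ k f) p)) p ∧
    iteratedFDeriv ℝ (k + 1) f p (fun _ => (1, 0)) =
      fderiv ℝ (iteratedFDeriv ℝ k f) p (1, 0) fun _ => (1, 0) := by
  constructor
  · have h1 : HasFDerivAt (iteratedFDeriv ℝ k f) (fderiv ℝ (iteratedFDeriv ℝ k f) p) p :=
      ((hf.differentiable_iteratedFDeriv (by exact_mod_cast ENat.natCast_lt_top k)) p).hasFDerivAt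
    exact (ContinuousMultilinearMap.apply ℝ (fun _ : Fin k => ℝ × ℝ) F
      fun _ => (1, 0)).hasFDerivAt.comp p h1
  · rw [iteratedFDeriv_succ_apply_left]
    rfl

lemma iterate_radialDeriv_eq_iteratedFDeriv {f : ℝ × ℝ → F} (hf : ContDiff ℝ ∞ f) (k : ℕ) :
    EqOn (radialDeriv^[k] f) (fun p => iteratedFDeriv ℝ k f p fun _ => (1, 0)) halfPlane := by
  induction k with
  | zero => intro p _; simp
  | succ k ih =>
    refine (eqOn_iterate_succ_radialDeriv ih).trans fun p hp => ?_
    obtain ⟨h1, h2⟩ := iteratedFDeriv_succ_radial hf k p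
    rw [radialDeriv, fderivWithin_halfPlane_eq hp h1.hasFDerivWithinAt]
    exact h2.symm

lemma iteratedDeriv_eq_iteratedFDeriv_radial {f : ℝ × ℝ → F} (hf : ContDiff ℝ ∞ f) (θ : ℝ)
    (k : ℕ) : iteratedDeriv k (fun t => f (t, θ)) =
      fun t => iteratedFDeriv ℝ k f (t, θ) fun _ => (1, 0) := by
  induction k with
  | zero => ext t; simp
  | succ k ih =>
    rw [iteratedDeriv_succ, ih]
    ext t
    obtain ⟨h1, h2⟩ := iteratedFDeriv_succ_radial hf k (t, θ)
    rw [h2]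
    exact (h1.comp_hasDerivAt t ((hasDerivAt_id t).prodMk (hasDerivAt_const t θ))).deriv

/-- **Borel's lemma** along the edge `r = 0`, depending smoothly on the parameter `θ`. -/
lemma exists_contDiff_iterate_radialDeriv_eq {c : ℕ → ℝ → ℂ} (hc : ∀ n, ContDiff ℝ ∞ (c n))
    (hs : ∀ n, HasCompactSupport (c n)) :
    ∃ B : ℝ × ℝ → ℂ, ContDiff ℝ ∞ B ∧ ∀ k θ, radialDeriv^[k] B (0, θ) = c k θ := by
  let κ : ContDiffBump (0 : ℝ) := ⟨1, 2, one_pos, one_lt_two⟩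
  let h : ℕ → ℝ × ℝ → ℂ := fun n p => (κ p.1 * (p.1 ^ n / n.factorial)) • c n p.2
  have hh : ∀ n, ContDiff ℝ ∞ (h n) := fun n =>
    ((κ.contDiff.comp contDiff_fst).mul ((contDiff_fst.pow n).div_const _)).smul
      ((hc n).comp contDiff_snd)
  have hhs : ∀ n, HasCompactSupport (h n) := fun n => by
    refine HasCompactSupport.intro (κ.hasCompactSupport.isCompact.prod (hs n).isCompact)
      fun p hp => ?_
    rcases not_and_or.1 (mem_prod.not.1 hp) with h1 | h1
    · simp [h, image_eq_zero_of_notMem_tsupport h1]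
    · simp [h, image_eq_zero_of_notMem_tsupport h1]
  obtain ⟨ε, hε, v, hv, hbd⟩ := exists_summable_rescaling hh hhs
  set f : ℕ → ℝ × ℝ → ℂ := fun n p => ε n ^ n • h n ((ε n)⁻¹ * p.1, p.2) with hf
  have hfs : ∀ n, ContDiff ℝ ∞ (f n) := fun n =>
    ((hh n).comp ((contDiff_const.mul contDiff_fst).prodMk contDiff_snd :
      ContDiff ℝ ∞ fun p : ℝ × ℝ => ((ε n)⁻¹ * p.1, p.2))).const_smul (ε n ^ n)
  have hB : ContDiff ℝ ∞ fun p => ∑' n, f n p :=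
    contDiff_tsum (N := ⊤) hfs (fun k _ => hv k) fun k n x _ => hbd k n x
  refine ⟨_, hB, fun k θ => ?_⟩
  have hcoef : ∀ n, (iteratedFDeriv ℝ k (f n) (0, θ) fun _ => (1, 0)) =
      if n = k then c k θ else 0 := fun n => by
    have hev : (fun t => f n (t, θ)) =ᶠ[𝓝 0] fun t : ℝ =>
        t ^ n • ((n.factorial : ℝ)⁻¹ • c n θ) := by
      filter_upwards [Metric.ball_mem_nhds (0 : ℝ) (hε n)] with t ht
      have hκ : κ ((ε n)⁻¹ * t) = 1 := by
        refine κ.one_of_mem_closedBall ?_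
        rw [mem_closedBall_zero_iff, norm_mul, norm_inv, Real.norm_of_nonneg (hε n).le,
          inv_mul_le_one₀ (hε n)]
        exact (mem_ball_zero_iff.1 ht).le
      have hne := (hε n).ne'
      simp only [hf, h, hκ, smul_smul]
      congr 1
      field_simp
      rw [← mul_pow, mul_div_cancel₀ _ hne]
    have h1 := congrFun (iteratedDeriv_eq_iteratedFDeriv_radial (hfs n) θ k) 0
    rw [← h1, hev.iteratedDeriv_eq]
    rw [iteratedDeriv_smul_const (contDiff_id.pow n).contDiffAt, iteratedDeriv_fun_pow_zero]
    rcases eq_or_ne n k with rfl | hnk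
    · simp [Nat.factorial_ne_zero]
    · simp [hnk, hnk.symm]
  rw [iterate_radialDeriv_eq_iteratedFDeriv hB k ⟨mem_Ici.2 le_rfl, mem_univ _⟩]
  have hts := iteratedFDeriv_tsum_apply (N := ⊤) hfs (fun k _ => hv k)
    (fun k n x _ => hbd k n x) (k := k) le_top ((0 : ℝ), θ)
  have hsum : Summable fun n => iteratedFDeriv ℝ k (f n) (0, θ) :=
    Summable.of_norm_bounded (hv k) fun n => hbd k n _
  change (iteratedFDeriv ℝ k (fun p => ∑' n, f n p) (0, θ)) _ = _
  rw [hts, ContinuousMultilinearMap.tsum_eval hsum]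
  simp only [hcoef, tsum_ite_eq]

end Borel

section Assembly

lemma exists_contDiff_ode {c : ℝ → ℂ} (hc : ContDiff ℝ ∞ c) (n : ℕ) :
    ∃ b : ℝ → ℂ, ContDiff ℝ ∞ b ∧
      ∀ θ, HasDerivAt b (-Complex.I * (c θ - n * b θ)) θ := by
  have hlin : ∀ (a : ℂ) (θ : ℝ), HasDerivAt (fun t : ℝ => Complex.exp (a * t))
      (Complex.exp (a * θ) * a) θ := fun a θ => by
    simpa using ((Complex.ofRealCLM.hasDerivAt (x := θ)).const_mul a).cexp
  have hexp : ∀ a : ℂ, ContDiff ℝ ∞ fun t : ℝ => Complex.exp (a * t) := fun a =>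
    (contDiff_const.mul Complex.ofRealCLM.contDiff).cexp
  set a : ℂ := Complex.I * n with ha
  set g : ℝ → ℂ := fun t => Complex.exp (-a * t) * (-Complex.I * c t) with hg
  have hgs : ContDiff ℝ ∞ g := (hexp (-a)).mul (contDiff_const.mul hc)
  set G : ℝ → ℂ := fun θ => ∫ t in (0 : ℝ)..θ, g t with hG
  have hGd : ∀ θ, HasDerivAt G (g θ) θ := fun θ => hgs.continuous.integral_hasStrictDerivAt 0 θ
    |>.hasDerivAt
  have hGs : ContDiff ℝ ∞ G :=
    contDiff_infty_iff_deriv.2 ⟨fun θ => (hGd θ).differentiableAt,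
      by rwa [show deriv G = g from funext fun θ => (hGd θ).deriv]⟩
  refine ⟨fun θ => Complex.exp (a * θ) * G θ, (hexp a).mul hGs, fun θ => ?_⟩
  refine ((hlin a θ).mul (hGd θ)).congr_deriv ?_
  have h1 : Complex.exp (a * θ) * Complex.exp (-a * θ) = 1 := by
    rw [← Complex.exp_add]; simp
  simp only [hg]
  linear_combination (-Complex.I * c θ) * h1 + Complex.exp (a * θ) * G θ * ha

lemma contDiffOn_smul_of_tsupport_subset {E F : Type*} [NormedAddCommGroup E] [NormedSpace ℝ E]
    [NormedAddCommGroup F] [NormedSpace ℝ F] {χ : E → ℝ} {f : E → F} {s U : Set E}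
    (hU : IsOpen U) (hχ : ContDiff ℝ ∞ χ) (hf : ContDiffOn ℝ ∞ f (s ∩ U))
    (hsub : tsupport χ ⊆ U) : ContDiffOn ℝ ∞ (fun p => χ p • f p) s := by
  intro p hp
  by_cases hpU : p ∈ U
  · exact (contDiffWithinAt_inter (hU.mem_nhds hpU)).1
      (hχ.contDiffWithinAt.smul (hf p ⟨hp, hpU⟩))
  · have hev : (fun q => χ q • f q) =ᶠ[𝓝 p] fun _ => 0 := by
      filter_upwards [(isClosed_tsupport χ).isOpen_compl.mem_nhds fun h => hpU (hsub h)] with q hq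
      rw [image_eq_zero_of_notMem_tsupport hq, zero_smul]
    exact (contDiffAt_const.congr_of_eventuallyEq hev).contDiffWithinAt

lemma exists_prod_bump {ρ δ : ℝ} (hρ : 0 < ρ) (hδ : 0 < δ) :
    ∃ χ : ℝ × ℝ → ℝ, ContDiff ℝ ∞ χ ∧
      tsupport χ ⊆ Icc (-(2 * ρ)) (2 * ρ) ×ˢ Icc (-(2 * δ)) (2 * δ) ∧
      ∀ r θ, |r| ≤ ρ → |θ| ≤ δ → χ (r, θ) = 1 := by
  let κ : ContDiffBump (0 : ℝ) := ⟨ρ, 2 * ρ, hρ, by linarith⟩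
  let μ : ContDiffBump (0 : ℝ) := ⟨δ, 2 * δ, hδ, by linarith⟩
  refine ⟨fun p => κ p.1 * μ p.2, (κ.contDiff.comp contDiff_fst).mul
    (μ.contDiff.comp contDiff_snd), ?_, fun r θ hr hθ => ?_⟩
  · refine closure_minimal (fun p hp => ?_) (isClosed_Icc.prod isClosed_Icc)
    have h1 : p.1 ∈ tsupport κ := subset_tsupport _ (left_ne_zero_of_mul hp)
    have h2 : p.2 ∈ tsupport μ := subset_tsupport _ (right_ne_zero_of_mul hp)
    rw [ContDiffBump.tsupport_eq, Real.closedBall_eq_Icc, zero_sub, zero_add] at h1 h2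
    exact ⟨h1, h2⟩
  · have h1 : κ r = 1 := κ.one_of_mem_closedBall (by simpa using hr)
    have h2 : μ θ = 1 := μ.one_of_mem_closedBall (by simpa using hθ)
    simp [h1, h2]

/-- Subtracting a function with prescribed edge jets leaves a right-hand side that is flat on the
edge. -/
lemma exists_flatOnEdge {f : ℝ × ℝ → ℂ} (hf : ContDiffOn ℝ ∞ f halfPlane) :
    ∃ B : ℝ × ℝ → ℂ, ContDiff ℝ ∞ B ∧ FlatOnEdge (Ioo (-1) 1) fun p =>
      f p + (p.1 • radialDeriv B p + Complex.I * fderivWithin ℝ B halfPlane p (0, 1)) := by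
  have hmem : ∀ θ : ℝ, ((0 : ℝ), θ) ∈ halfPlane := fun θ => ⟨mem_Ici.2 le_rfl, mem_univ _⟩
  have hcoef : ∀ n, ContDiff ℝ ∞ fun θ => radialDeriv^[n] f (0, θ) := fun n =>
    contDiffOn_univ.1 ((contDiffOn_iterate_radialDeriv hf n).comp
      (contDiff_const.prodMk contDiff_id).contDiffOn fun θ _ => hmem θ)
  choose b hb hode using fun n => exists_contDiff_ode (hcoef n) n
  let η : ContDiffBump (0 : ℝ) := ⟨1, 2, one_pos, one_lt_two⟩
  obtain ⟨B, hB, hjet⟩ := exists_contDiff_iterate_radialDeriv_eq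
    (c := fun n θ => η θ • -b n θ) (fun n => η.contDiff.smul (hb n).neg)
    (fun n => η.hasCompactSupport.smul_right)
  have hBP : ContDiffOn ℝ ∞ B halfPlane := hB.contDiffOn
  let A : (ℝ × ℝ →L[ℝ] ℂ) →L[ℝ] ℂ :=
    (ContinuousLinearMap.mul ℝ ℂ Complex.I).comp (ContinuousLinearMap.apply ℝ ℂ (0, 1))
  have hd := contDiffOn_fderivWithin_halfPlane hBP
  have h1 : ContDiffOn ℝ ∞ (fun p => p.1 • radialDeriv B p) halfPlane :=
    contDiff_fst.contDiffOn.smul (contDiffOn_radialDeriv hBP)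
  have h2 : ContDiffOn ℝ ∞ (fun p => A (fderivWithin ℝ B halfPlane p)) halfPlane :=
    A.contDiff.comp_contDiffOn hd
  refine ⟨B, hB, hf.add (h1.add h2), fun k θ hθ => ?_⟩
  change radialDeriv^[k] (fun p => f p + (p.1 • radialDeriv B p +
    A (fderivWithin ℝ B halfPlane p))) (0, θ) = 0
  have hη : ∀ t ∈ Ioo (-1 : ℝ) 1, η t = 1 := fun t ht =>
    η.one_of_mem_closedBall (by
      rw [mem_closedBall_zero_iff, Real.norm_eq_abs]; exact (abs_lt.2 ht).le)
  have hang : fderivWithin ℝ (radialDeriv^[k] B) halfPlane (0, θ) (0, 1) =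
      -(-Complex.I * (radialDeriv^[k] f (0, θ) - k * b k θ)) := by
    refine (hasDerivAt_angular (contDiffOn_iterate_radialDeriv hBP k) le_rfl θ).unique
      ((hode k θ).neg.congr_of_eventuallyEq ?_)
    filter_upwards [isOpen_Ioo.mem_nhds hθ] with t ht
    simp [hjet, hη t ht]
  rw [iterate_radialDeriv_add hf (h1.add h2) k (hmem θ)]
  beta_reduce
  rw [iterate_radialDeriv_add h1 h2 k (hmem θ)]
  beta_reduce
  rw [iterate_radialDeriv_euler hBP k (hmem θ), iterate_radialDeriv_clm hd A k (hmem θ)]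
  beta_reduce
  rw [iterate_radialDeriv_fderivWithin hBP k (hmem θ), hjet k, hη θ hθ]
  change radialDeriv^[k] f (0, θ) + ((0 : ℝ) • radialDeriv^[k + 1] B (0, θ) +
    (k : ℝ) • (1 : ℝ) • -b k θ +
    Complex.I * fderivWithin ℝ (radialDeriv^[k] B) halfPlane (0, θ) (0, 1)) = 0
  rw [hang, zero_smul, one_smul, Complex.real_smul, Complex.ofReal_natCast]
  linear_combination (radialDeriv^[k] f (0, θ) - k * b k θ) * Complex.I_mul_I

lemma FlatOnEdge.flatSupported {f : ℝ × ℝ → ℂ} (h : FlatOnEdge (Ioo (-1) 1) f)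
    {χ : ℝ × ℝ → ℝ} (hχ : ContDiff ℝ ∞ χ)
    (hsub : tsupport χ ⊆ Icc (-2) 2 ×ˢ Icc (-(1 / 2)) (1 / 2)) :
    FlatSupported 2 fun p => χ p • halfPlane.indicator f p := by
  constructor
  · refine contDiffOn_univ.1 (contDiffOn_smul_of_tsupport_subset (U := univ ×ˢ Ioo (-1) 1)
      (isOpen_univ.prod isOpen_Ioo) hχ ?_ fun p hp => ?_)
    · rw [univ_inter]
      exact contDiffOn_infty.2 fun n => FlatOnEdge.contDiffOn_indicator isOpen_Ioo n h
    · obtain ⟨-, h1, h2⟩ := hsub hp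
      exact ⟨mem_univ _, by linarith, by linarith⟩
  · refine closure_minimal (fun p hp => ?_) (isClosed_Icc.prod isClosed_Icc)
    obtain ⟨⟨-, h1⟩, h2, h3⟩ := hsub (subset_tsupport _ (left_ne_zero_of_smul hp))
    have h4 : p ∈ halfPlane := mem_of_indicator_ne_zero (right_ne_zero_of_smul hp)
    exact ⟨⟨h4.1, h1⟩, by linarith, by linarith⟩

lemma exists_solution_near_edge {f : ℝ × ℝ → ℂ} (hf : ContDiffOn ℝ ∞ f halfPlane) :
    ∃ Φ : ℝ × ℝ → ℂ, ContDiff ℝ ∞ Φ ∧ ∀ r θ : ℝ, 0 < r → r ≤ 1 → |θ| ≤ 1 / 4 →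
      (r : ℂ) * deriv (fun t : ℝ => Φ (t, θ)) r
        + Complex.I * deriv (fun t : ℝ => Φ (r, t)) θ = f (r, θ) := by
  obtain ⟨B, hB, hflat⟩ := exists_flatOnEdge hf
  obtain ⟨χ, hχ, hsub, hone⟩ := exists_prod_bump one_pos (δ := 1 / 4) (by norm_num)
  obtain ⟨Φ, hΦ, hsol⟩ :=
    (hflat.flatSupported hχ (hsub.trans_eq (by norm_num))).exists_solution
  refine ⟨fun p => Φ p - B p, hΦ.sub hB, fun r θ hr hr1 hθ => ?_⟩
  have hs := hsol r θ hr (by linarith)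
  have hp : (r, θ) ∈ halfPlane := ⟨hr.le, mem_univ _⟩
  have hBP : ContDiffOn ℝ ∞ B halfPlane := hB.contDiffOn
  have hdr := hasDerivAt_radial hBP hr θ
  have hda := hasDerivAt_angular hBP hr.le θ
  have hdr' := (hasDerivAt_radial hΦ.contDiffOn hr θ).differentiableAt
  have hda' := (hasDerivAt_angular hΦ.contDiffOn hr.le θ).differentiableAt
  rw [hone r θ (by rwa [abs_of_pos hr]) hθ, one_smul, indicator_of_mem hp,
    Complex.real_smul] at hs
  rw [deriv_fun_sub hdr' hdr.differentiableAt, deriv_fun_sub hda' hda.differentiableAt,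
    hdr.deriv, hda.deriv]
  linear_combination hs

end Assembly

end PolarDbar

/-- Local exactness at boundary points of the resolution
`0 → O → A⁰ → A^{0,1}(log E) → 0` on the real blow-up of a disc in its origin
(Fact Dc:fact1): in polar coordinates, the equation
`(1/2)(r ∂Φ/∂r + i ∂Φ/∂θ) = Ψ` has, near each boundary point, a solution `Φ`
which is `C^∞` up to the boundary `{r = 0}`. -/
theorem dbar_solvable_up_to_boundary
    (R a b : ℝ) (hR : 0 < R) (hab : a < b)
    (Ψ : ℝ × ℝ → ℂ)
    (hΨ : ContDiffOn ℝ (⊤ : ℕ∞) Ψ (Set.Ico 0 R ×ˢ Set.Ioo a b)) :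
    ∀ θ₀ ∈ Set.Ioo a b, ∃ δ : ℝ, 0 < δ ∧ ∃ R' : ℝ, 0 < R' ∧ R' ≤ R ∧
      ∃ Φ : ℝ × ℝ → ℂ,
        ContDiffOn ℝ (⊤ : ℕ∞) Φ (Set.Ico 0 R' ×ˢ Set.Ioo (θ₀ - δ) (θ₀ + δ)) ∧
        ∀ r θ : ℝ, 0 < r → r < R' → |θ - θ₀| < δ →
          (1 / 2 : ℂ) * ((r : ℂ) * deriv (fun t : ℝ => Φ (t, θ)) r
            + Complex.I * deriv (fun t : ℝ => Φ (r, t)) θ) = Ψ (r, θ) := by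
  rintro θ₀ ⟨ha, hb⟩
  set d : ℝ := min (θ₀ - a) (b - θ₀) / 2 with hd
  have hd0 : 0 < d := half_pos (lt_min (sub_pos.2 ha) (sub_pos.2 hb))
  have hda : 2 * d ≤ θ₀ - a := by rw [hd, mul_div_cancel₀ _ two_ne_zero]; exact min_le_left _ _
  have hdb : 2 * d ≤ b - θ₀ := by rw [hd, mul_div_cancel₀ _ two_ne_zero]; exact min_le_right _ _
  obtain ⟨χ, hχ, hsub, hone⟩ :=
    PolarDbar.exists_prod_bump (ρ := R / 4) (δ := d / 2) (by positivity) (by positivity)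
  have hΨ' : ContDiffOn ℝ ∞ (fun p : ℝ × ℝ => (2 : ℝ) • Ψ (p.1, θ₀ + p.2))
      (PolarDbar.halfPlane ∩ Iio R ×ˢ Ioo (a - θ₀) (b - θ₀)) :=
    (hΨ.comp (contDiff_fst.prodMk (contDiff_const.add contDiff_snd)).contDiffOn
      fun p hp => ⟨⟨hp.1.1, hp.2.1⟩, by linarith [hp.2.2.1], by linarith [hp.2.2.2]⟩).const_smul _
  obtain ⟨Φ, hΦ, hsol⟩ := PolarDbar.exists_solution_near_edge
    (PolarDbar.contDiffOn_smul_of_tsupport_subset (isOpen_Iio.prod isOpen_Ioo) hχ hΨ'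
      fun p hp => by
        obtain ⟨⟨-, h1⟩, h2, h3⟩ := hsub hp
        exact ⟨mem_Iio.2 (by linarith), by linarith, by linarith⟩)
  refine ⟨min (d / 2) (1 / 4), by positivity, min 1 (R / 4), by positivity,
    (min_le_right _ _).trans (by linarith), fun p => Φ (p.1, p.2 - θ₀),
    (hΦ.comp (contDiff_fst.prodMk (contDiff_snd.sub contDiff_const))).contDiffOn,
    fun r θ hr hr' hθ => ?_⟩
  obtain ⟨hr1, hr2⟩ := lt_min_iff.1 hr'
  obtain ⟨hθ1, hθ2⟩ := lt_min_iff.1 hθ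
  have h := hsol r (θ - θ₀) hr hr1.le hθ2.le
  rw [hone r (θ - θ₀) (by rw [abs_of_pos hr]; exact hr2.le) hθ1.le, one_smul,
    add_sub_cancel, Complex.real_smul] at h
  have hshift : deriv (fun t : ℝ => Φ (r, t - θ₀)) θ = deriv (fun t : ℝ => Φ (r, t)) (θ - θ₀) :=
    deriv_comp_sub_const (f := fun t : ℝ => Φ (r, t)) θ₀ θ
  rw [hshift, h]
  push_cast
  ring
end
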